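/- arXiv:2209.09672 — 3 statements merged into one kernel-verified Lean document; each statement's English description precedes it below -/
import Mathlib

section
/- There exist absolute constants c₁, c₂ > 0 such that the following holds. Let d ≤ 3, η ∈ (0, 1/(4−d)), and set c_V = c₁(1 + ‖V‖_∞^{1/2})^{−1/2}. Let Ψ be a solution of the Schrödinger equation (−Δ + V)Ψ = EΨ on the torus 𝕋^d_L with ‖Ψ‖_{L²(𝕋^d_L)} = 1 and eigenvalue E ∈ [(2c_V/L)^{4/(1+dη)}, min(c_V^{4/(1+dη)}, c₂^{2/(dη)})], where L is sufficiently large. Then for every x₀ ∈ 𝕋^d_L, either ∫_{B(x₀, c_V E^{−1/4+η(1−d/4)})} |Ψ|² dμ < 1/2, or ∫_{𝕋^d_L ∖ B(x₀, c_V E^{−1/4−dη/4})} |Ψ|² dμ > E. -/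
open MeasureTheory Real Filter

noncomputable section

/-- The `i`-th generator of the lattice `L·ℒ₀ = ℤ(L·e₁) ⊕ ℤ(L·γ₁·e₂) ⊕ ⋯ ⊕ ℤ(L·γ_{d-1}·e_d)`. -/
def latVec (d : ℕ) (L : ℝ) (γ : Fin d → ℝ) (i : Fin d) : EuclideanSpace ℝ (Fin d) :=
  EuclideanSpace.single i (L * γ i)

/-- `f : ℝ^d → α` is periodic with respect to the lattice `L·ℒ₀` (equivalently,
it descends to the torus `𝕋^d_L = ℝ^d / L·ℒ₀`). -/
def LatPeriodic {α : Type*} (d : ℕ) (L : ℝ) (γ : Fin d → ℝ)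
    (f : EuclideanSpace ℝ (Fin d) → α) : Prop :=
  ∀ (x : EuclideanSpace ℝ (Fin d)) (i : Fin d), f (x + latVec d L γ i) = f x

/-- A fundamental domain for the torus `𝕋^d_L = ℝ^d / L·ℒ₀`. -/
def fund (d : ℕ) (L : ℝ) (γ : Fin d → ℝ) : Set (EuclideanSpace ℝ (Fin d)) :=
  {x | ∀ i, x i ∈ Set.Ico (0 : ℝ) (L * γ i)}

/-- The quotient (torus) distance on `𝕋^d_L`, computed between representatives in `ℝ^d`. -/
def torusDist (d : ℕ) (L : ℝ) (γ : Fin d → ℝ)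
    (x y : EuclideanSpace ℝ (Fin d)) : ℝ :=
  ⨅ v : Fin d → ℤ, ‖x - y - ∑ i, (v i : ℝ) • latVec d L γ i‖

/-- The (periodized) open ball `B(x₀, ρ)` of the torus metric, as a subset of `ℝ^d`. -/
def torusBall (d : ℕ) (L : ℝ) (γ : Fin d → ℝ)
    (x₀ : EuclideanSpace ℝ (Fin d)) (ρ : ℝ) : Set (EuclideanSpace ℝ (Fin d)) :=
  {x | torusDist d L γ x x₀ < ρ}

/-- The Euclidean Laplacian `Δf = ∑ᵢ ∂²f/∂xᵢ²`. -/
def lap (d : ℕ) (f : EuclideanSpace ℝ (Fin d) → ℂ)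
    (x : EuclideanSpace ℝ (Fin d)) : ℂ :=
  ∑ i, fderiv ℝ (fun y => fderiv ℝ f y (EuclideanSpace.single i 1)) x
      (EuclideanSpace.single i 1)

/-- The squared norm of the gradient, `|∇f|² = ∑ᵢ |∂f/∂xᵢ|²`. -/
def gradSq (d : ℕ) (f : EuclideanSpace ℝ (Fin d) → ℂ)
    (x : EuclideanSpace ℝ (Fin d)) : ℝ :=
  ∑ i, ‖fderiv ℝ f x (EuclideanSpace.single i 1)‖ ^ 2

/-- An `L²`-normalized solution of the stationary Schrödinger equation
`(-Δ + V)Ψ = EΨ` on the torus `𝕋^d_L`. -/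
def IsSolution (d : ℕ) (L : ℝ) (γ : Fin d → ℝ)
    (V : EuclideanSpace ℝ (Fin d) → ℝ) (E : ℝ)
    (Ψ : EuclideanSpace ℝ (Fin d) → ℂ) : Prop :=
  ContDiff ℝ 2 Ψ ∧ LatPeriodic d L γ Ψ ∧
    (∀ x, -lap d Ψ x + (V x : ℂ) * Ψ x = (E : ℂ) * Ψ x) ∧
    (∫ x in fund d L γ, ‖Ψ x‖ ^ 2) = 1

/-- `r_d(n)`: the number of lattice points `ξ ∈ ℤ^d` with `|ξ|² = n`. -/
def rd (d n : ℕ) : ℕ := Nat.card {ξ : Fin d → ℤ // ∑ i, (ξ i) ^ 2 = (n : ℤ)}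

/-- The character `e(ξ·x/r') = e^{2πi ξ·x/r'}`. -/
def ec (d : ℕ) (r' : ℝ) (ξ : Fin d → ℤ) (x : EuclideanSpace ℝ (Fin d)) : ℂ :=
  Complex.exp (2 * Real.pi * Complex.I * (∑ i, (ξ i : ℂ) * (x i : ℂ)) / (r' : ℂ))

lemma fund_subset_compact (d : ℕ) (L : ℝ) (γ : Fin d → ℝ) :
    ∃ K, IsCompact K ∧ fund d L γ ⊆ K := by
  refine ⟨(EuclideanSpace.equiv (Fin d) ℝ).toHomeomorph ⁻¹'
    (Set.Icc 0 (fun i => L * γ i)),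
    (Homeomorph.isCompact_preimage _).2 isCompact_Icc, ?_⟩
  intro x hx
  exact ⟨fun i => (hx i).1, fun i => (hx i).2.le⟩

lemma cont_integrableOn_fund (d : ℕ) (L : ℝ) (γ : Fin d → ℝ)
    {g : EuclideanSpace ℝ (Fin d) → ℝ} (hg : Continuous g) :
    IntegrableOn g (fund d L γ) := by
  obtain ⟨K, hK, hs⟩ := fund_subset_compact d L γ
  exact (hg.continuousOn.integrableOn_compact hK).mono_set hs

lemma measurableSet_fund (d : ℕ) (L : ℝ) (γ : Fin d → ℝ) :
    MeasurableSet (fund d L γ) := by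
  have : fund d L γ = ⋂ i, (fun x : EuclideanSpace ℝ (Fin d) => x i) ⁻¹'
      Set.Ico (0:ℝ) (L * γ i) := by
    ext x; simp [fund]
  rw [this]
  refine MeasurableSet.iInter fun i => ?_
  exact (by fun_prop : Continuous (fun x : EuclideanSpace ℝ (Fin d) => x i)).measurable
    measurableSet_Ico

lemma setIntegral_fund (n : ℕ) (L : ℝ) (γ : Fin n → ℝ)
    (g : EuclideanSpace ℝ (Fin n) → ℝ) :
    ∫ x in fund n L γ, g x =
      ∫ y in Set.Icc (0 : Fin n → ℝ) (fun i => L * γ i), g (WithLp.toLp 2 y) := by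
  have h1 := (PiLp.volume_preserving_toLp (Fin n)).setIntegral_preimage_emb
    (MeasurableEquiv.toLp 2 (Fin n → ℝ)).measurableEmbedding g (fund n L γ)
  rw [← h1]
  apply setIntegral_congr_set
  have : (WithLp.toLp 2 ⁻¹' fund n L γ : Set (Fin n → ℝ)) =
      Set.pi Set.univ (fun i => Set.Ico ((0 : Fin n → ℝ) i) (L * γ i)) := by
    ext y; simp [fund]
  rw [this]
  exact Measure.univ_pi_Ico_ae_eq_Icc (f := (0 : Fin n → ℝ)) (g := fun i => L * γ i)

lemma torus_div (n : ℕ) (L : ℝ) (hL : 0 < L) (γ : Fin (n+1) → ℝ) (hγ : ∀ i, 1 ≤ γ i)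
    (F : Fin (n+1) → EuclideanSpace ℝ (Fin (n+1)) → ℝ) (hF : ∀ j, ContDiff ℝ 1 (F j))
    (hp : ∀ j, LatPeriodic (n+1) L γ (F j)) :
    ∫ x in fund (n+1) L γ, ∑ j, fderiv ℝ (F j) x (EuclideanSpace.single j 1) = 0 := by
  rw [setIntegral_fund]
  have hcl : ∀ j x, HasFDerivAt (fun y : Fin (n+1) → ℝ => F j (WithLp.toLp 2 y))
      ((fderiv ℝ (F j) (WithLp.toLp 2 x)).comp
        ((EuclideanSpace.equiv (Fin (n+1)) ℝ).symm : (Fin (n+1) → ℝ) →L[ℝ] _)) x := by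
    intro j x
    have h1 := ((hF j).differentiable one_ne_zero (WithLp.toLp 2 x)).hasFDerivAt
    exact HasFDerivAt.comp (g := F j) x h1
      ((EuclideanSpace.equiv (Fin (n+1)) ℝ).symm.toContinuousLinearMap.hasFDerivAt)
  have key := integral_divergence_of_hasFDerivAt_off_countable'
    (0 : Fin (n+1) → ℝ) (fun i => L * γ i)
    (fun i => by have := hγ i; simp; positivity)
    (fun j y => F j (WithLp.toLp 2 y)) _ ∅ Set.countable_empty
    (fun j => fun x _ => (hcl j x).continuousAt.continuousWithinAt)
    (fun x _ j => hcl j x) ?_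
  · have e : ∀ j, (EuclideanSpace.equiv (Fin (n+1)) ℝ).symm (Pi.single j 1)
      = EuclideanSpace.single j (1:ℝ) := fun j => rfl
    simp only [ContinuousLinearMap.comp_apply, ContinuousLinearEquiv.coe_coe, e] at key
    rw [key]
    apply Finset.sum_eq_zero
    intro i _
    rw [sub_eq_zero]
    congr 1
    ext y
    have := hp i (WithLp.toLp 2 (i.insertNth (0:ℝ) y)) i
    simp only [Pi.zero_apply]
    rw [← this]
    congr 1
    ext j
    simp only [latVec, PiLp.add_apply]
    rcases eq_or_ne j i with rfl | hne
    · simp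
    · obtain ⟨k, rfl⟩ := Fin.exists_succAbove_eq hne
      simp
  · refine ContinuousOn.integrableOn_compact isCompact_Icc ?_
    refine Continuous.continuousOn ?_
    refine continuous_finsetSum _ fun j _ => ?_
    have h2 := (hF j).continuous_fderiv one_ne_zero
    have h3 : Continuous (fun x : Fin (n+1) → ℝ => fderiv ℝ (F j) (WithLp.toLp 2 x)) :=
      h2.comp (EuclideanSpace.equiv (Fin (n+1)) ℝ).symm.continuous
    exact h3.clm_apply continuous_const

lemma fderiv_periodic {n : ℕ} {L : ℝ} {γ : Fin n → ℝ} {f : EuclideanSpace ℝ (Fin n) → ℂ}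
    (hf : LatPeriodic n L γ f) : LatPeriodic n L γ (fderiv ℝ f) := by
  intro x i
  rw [← fderiv_comp_add_right]
  congr 1
  ext y
  exact hf y i

lemma main_ineq (n : ℕ) (L : ℝ) (hL : 0 < L) (γ : Fin (n+1) → ℝ) (hγ : ∀ i, 1 ≤ γ i)
    (V : EuclideanSpace ℝ (Fin (n+1)) → ℝ) (hV : ∀ x, 0 ≤ V x) (E : ℝ)
    (Ψ : EuclideanSpace ℝ (Fin (n+1)) → ℂ) (hΨ : IsSolution (n+1) L γ V E Ψ)
    (p q w : ℝ → ℝ) (hp : ∀ t, HasDerivAt p (q t) t) (hq : ∀ t, HasDerivAt q (w t) t)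
    (hw : Continuous w) (p0 : ∀ t, 0 ≤ p t) (pp : ∀ t, p (t + L * γ 0) = p t)
    (qp : ∀ t, q (t + L * γ 0) = q t) :
    ∫ x in fund (n+1) L γ, ‖Ψ x‖ ^ 2 * (- w (x 0) - 2 * E * p (x 0)) ≤ 0 := by
  obtain ⟨hC, hper, heq, -⟩ := hΨ
  set D : Fin (n+1) → EuclideanSpace ℝ (Fin (n+1)) → ℂ :=
    fun j x => fderiv ℝ Ψ x (EuclideanSpace.single j 1) with hD
  have hΨd : ∀ x, HasFDerivAt Ψ (fderiv ℝ Ψ x) x := fun x =>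
    (hC.differentiable two_ne_zero x).hasFDerivAt
  have hDC : ∀ j, ContDiff ℝ 1 (D j) := fun j =>
    (hC.fderiv_right (m := 1) (by norm_num)).clm_apply contDiff_const
  have hDd : ∀ j x, HasFDerivAt (D j) (fderiv ℝ (D j) x) x := fun j x =>
    ((hDC j).differentiable one_ne_zero x).hasFDerivAt
  have hqC : ContDiff ℝ 1 q := by
    rw [contDiff_one_iff_deriv]
    refine ⟨fun t => (hq t).differentiableAt, ?_⟩
    rwa [show deriv q = w from funext fun t => (hq t).deriv]
  have hpC : ContDiff ℝ 1 p := by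
    rw [contDiff_one_iff_deriv]
    refine ⟨fun t => (hp t).differentiableAt, ?_⟩
    rw [show deriv p = q from funext fun t => (hp t).deriv]
    exact hqC.continuous
  have hproj : ContDiff ℝ 1 (fun x : EuclideanSpace ℝ (Fin (n+1)) => x 0) :=
    (EuclideanSpace.proj (𝕜 := ℝ) (0 : Fin (n+1))).contDiff
  have hprojd : ∀ x, HasFDerivAt (fun x : EuclideanSpace ℝ (Fin (n+1)) => x 0)
      (EuclideanSpace.proj (𝕜 := ℝ) (0 : Fin (n+1)) : EuclideanSpace ℝ (Fin (n+1)) →L[ℝ] ℝ) x :=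
    fun x => (EuclideanSpace.proj (𝕜 := ℝ) (0 : Fin (n+1))).hasFDerivAt
  set c : Fin (n+1) → ℝ := fun j => if j = 0 then 1 else 0 with hc
  set F : Fin (n+1) → EuclideanSpace ℝ (Fin (n+1)) → ℝ := fun j x =>
    p (x 0) * (2 * inner ℝ (Ψ x) (D j x)) - ‖Ψ x‖ ^ 2 * (q (x 0) * c j) with hFdef
  have hC1 : ContDiff ℝ 1 Ψ := hC.of_le (by norm_num)
  have hFC : ∀ j, ContDiff ℝ 1 (F j) := by
    intro j
    refine ContDiff.sub ?_ ?_
    · exact (hpC.comp hproj).mul (contDiff_const.mul (hC1.inner ℝ (hDC j)))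
    · exact (hC1.norm_sq ℝ).mul ((hqC.comp hproj).mul contDiff_const)
  have hc0 : ∀ (x : EuclideanSpace ℝ (Fin (n+1))) i, (x + latVec (n+1) L γ i) 0 =
      if i = 0 then x 0 + L * γ 0 else x 0 := by
    intro x i
    simp only [latVec, PiLp.add_apply]
    by_cases h : i = 0
    · subst h; simp
    · simp [h, Ne.symm h]
  have hFp : ∀ j, LatPeriodic (n+1) L γ (F j) := by
    intro j x i
    have h1 : p ((x + latVec (n+1) L γ i) 0) = p (x 0) := by
      rw [hc0]; split_ifs <;> simp [pp]
    have h2 : q ((x + latVec (n+1) L γ i) 0) = q (x 0) := by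
      rw [hc0]; split_ifs <;> simp [qp]
    simp only [hFdef, hD, h1, h2, hper x i, fderiv_periodic hper x i]
  have hdiv := torus_div n L hL γ hγ F hFC hFp
  have hFder : ∀ j x, fderiv ℝ (F j) x (EuclideanSpace.single j 1) =
      p (x 0) * (2 * ‖D j x‖ ^ 2 + 2 * inner ℝ (Ψ x)
        (fderiv ℝ (D j) x (EuclideanSpace.single j 1))) - ‖Ψ x‖ ^ 2 * (w (x 0) * c j) := by
    intro j x
    have a1 := ((hp (x 0)).comp_hasFDerivAt x (hprojd x)).mul
      (((hΨd x).inner ℝ (hDd j x)).const_mul 2)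
    have a2 := ((hΨd x).norm_sq).mul
      (((hq (x 0)).comp_hasFDerivAt x (hprojd x)).mul_const (c j))
    have a3 := (a1.sub a2).fderiv
    have a4 : fderiv ℝ (F j) x = _ := a3
    rw [a4]
    have hs : (EuclideanSpace.single j (1:ℝ) : EuclideanSpace ℝ (Fin (n+1))) 0 = c j := by
      simp [hc, eq_comm]
    have hcc : c j * c j = c j := by simp [hc]
    have hn : inner ℝ (D j x) (D j x) = ‖D j x‖ ^ 2 := real_inner_self_eq_norm_sq _
    have hDx : fderiv ℝ Ψ x (EuclideanSpace.single j 1) = D j x := rfl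
    simp [fderivInnerCLM_apply, hDx]
    rcases eq_or_ne j 0 with rfl | hj
    · simp [hc]
      ring
    · rw [if_neg (Ne.symm hj), if_neg (Ne.symm hj)]
      simp only [hc, if_neg hj]
      ring
  have hlap : ∀ x, ∑ j, inner ℝ (Ψ x) (fderiv ℝ (D j) x (EuclideanSpace.single j 1))
      = (V x - E) * ‖Ψ x‖ ^ 2 := by
    intro x
    rw [← inner_sum]
    have : ∑ j, fderiv ℝ (D j) x (EuclideanSpace.single j 1) = (V x - E) • Ψ x := by
      have := heq x
      simp only [lap] at this
      rw [Complex.real_smul]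
      push_cast
      linear_combination -this
    rw [this, inner_smul_right, real_inner_self_eq_norm_sq]
  have hsum : ∀ x, ∑ j, fderiv ℝ (F j) x (EuclideanSpace.single j 1) =
      p (x 0) * (2 * ∑ j, ‖D j x‖ ^ 2 + 2 * ((V x - E) * ‖Ψ x‖ ^ 2)) - ‖Ψ x‖ ^ 2 * w (x 0) := by
    intro x
    simp only [hFder]
    rw [Finset.sum_sub_distrib, ← Finset.mul_sum, ← Finset.mul_sum, ← Finset.mul_sum,
      Finset.sum_add_distrib, ← Finset.mul_sum, ← Finset.mul_sum, hlap]
    simp [hc]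
  have hΨc := hC.continuous
  have hcoord : Continuous (fun x : EuclideanSpace ℝ (Fin (n+1)) => x 0) := hproj.continuous
  rw [← hdiv]
  refine setIntegral_mono_on ?_ ?_ (measurableSet_fund _ _ _) ?_
  · apply cont_integrableOn_fund
    have := hw.comp hcoord
    have := hpC.continuous.comp hcoord
    simp only [Function.comp_def] at *
    fun_prop
  · apply cont_integrableOn_fund
    refine continuous_finsetSum _ fun j _ => ?_
    exact ((hFC j).continuous_fderiv one_ne_zero).clm_apply continuous_const
  · intro x _
    rw [hsum]
    have h1 : 0 ≤ ∑ j, ‖D j x‖ ^ 2 := Finset.sum_nonneg fun j _ => by positivity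
    have h2 := mul_nonneg (p0 (x 0)) h1
    have h3 := mul_nonneg (p0 (x 0)) (mul_nonneg (hV x) (sq_nonneg ‖Ψ x‖))
    nlinarith

lemma trig_low (θ : ℝ) : -(3/4) ≤ cos θ + cos (2 * θ) / 2 := by
  rw [cos_two_mul]; nlinarith [sq_nonneg (cos θ + 1/2)]

lemma trig_hi (θ : ℝ) (h : |θ| ≤ 1/10) : 1.48 ≤ cos θ + cos (2 * θ) / 2 := by
  have h1 := one_sub_sq_div_two_le_cos (x := θ)
  have h2 := one_sub_sq_div_two_le_cos (x := 2 * θ)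
  have h3 : θ ^ 2 ≤ (1/10) ^ 2 := by
    rw [← sq_abs]; exact pow_le_pow_left₀ (abs_nonneg _) h 2
  nlinarith

lemma core (n : ℕ) (L : ℝ) (hL : 0 < L) (γ : Fin (n+1) → ℝ) (hγ : ∀ i, 1 ≤ γ i)
    (hγ0 : γ 0 = 1)
    (V : EuclideanSpace ℝ (Fin (n+1)) → ℝ) (hV : ∀ x, 0 ≤ V x) (E : ℝ) (hE : 0 < E)
    (Ψ : EuclideanSpace ℝ (Fin (n+1)) → ℂ) (hΨ : IsSolution (n+1) L γ V E Ψ)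
    (x₀ : EuclideanSpace ℝ (Fin (n+1))) (r : ℝ)
    (N : ℕ) (k : ℝ) (hk : k * L = 2 * π * N) (hk0 : 0 < k) (hkE : 20 * E ≤ k ^ 2)
    (hkr : k * r ≤ 1 / 10) :
    (∫ x in fund (n+1) L γ ∩ torusBall (n+1) L γ x₀ r, ‖Ψ x‖ ^ 2) < 1 / 2 := by
  set θ : ℝ → ℝ := fun t => k * (t - x₀ 0) with hθ
  have hθd : ∀ t, HasDerivAt θ k t := fun t => by
    simpa using ((hasDerivAt_id t).sub_const (x₀ 0)).const_mul k
  have hθ2d : ∀ t, HasDerivAt (fun t => 2 * θ t) (2 * k) t := fun t => (hθd t).const_mul 2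
  have hθs : ∀ (t : ℝ) (v : ℤ), θ t = θ (t - v * L) + (v * N : ℤ) * (2 * π) := by
    intro t v
    simp only [hθ]; push_cast
    linear_combination (v : ℝ) * hk
  have hcosp : ∀ (t : ℝ) (v : ℤ), cos (θ t) = cos (θ (t - v * L)) := by
    intro t v
    rw [hθs t v, cos_add_int_mul_two_pi]
  have hθs1 : ∀ t : ℝ, θ (t + L) = θ t + (N : ℕ) * (2 * π) := by
    intro t
    simp only [hθ]
    linear_combination hk
  have hθs2 : ∀ t : ℝ, 2 * θ (t + L) = 2 * θ t + (2 * N : ℕ) * (2 * π) := by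
    intro t
    rw [hθs1]; push_cast; ring
  have M := main_ineq n L hL γ hγ V hV E Ψ hΨ
    (fun t => 1 + cos (θ t) + cos (2 * θ t) / 8)
    (fun t => - k * sin (θ t) - k / 4 * sin (2 * θ t))
    (fun t => - k ^ 2 * (cos (θ t) + cos (2 * θ t) / 2))
    (by
      intro t
      have := (((hθd t).cos).const_add 1).add ((hθ2d t).cos.div_const 8)
      refine this.congr_deriv ?_
      ring)
    (by
      intro t
      have := ((hθd t).sin.const_mul (-k)).sub ((hθ2d t).sin.const_mul (k/4))
      refine this.congr_deriv ?_
      ring)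
    (by fun_prop)
    (by
      intro t
      simp only [cos_two_mul]
      nlinarith [sq_nonneg (cos (θ t) + 1), neg_one_le_cos (θ t)])
    (by
      intro t
      simp only [hγ0, mul_one, hθs2]
      rw [hθs1, cos_add_nat_mul_two_pi, cos_add_nat_mul_two_pi])
    (by
      intro t
      simp only [hγ0, mul_one, hθs2]
      rw [hθs1, sin_add_nat_mul_two_pi, sin_add_nat_mul_two_pi])
  obtain ⟨hC, -, -, hnorm⟩ := hΨ
  have hcoord : Continuous (fun x : EuclideanSpace ℝ (Fin (n+1)) => x 0) := by fun_prop
  have hθc : Continuous (fun x : EuclideanSpace ℝ (Fin (n+1)) => θ (x 0)) := by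
    simp only [hθ]; fun_prop
  have hu : Continuous (fun x => ‖Ψ x‖ ^ 2) := by
    have := hC.continuous
    fun_prop
  have hui := cont_integrableOn_fund (n+1) L γ hu
  set S : Set (EuclideanSpace ℝ (Fin (n+1))) :=
    {x | 1.48 ≤ cos (θ (x 0)) + cos (2 * θ (x 0)) / 2} with hS
  have hSm : MeasurableSet S := (isClosed_le continuous_const (by fun_prop)).measurableSet
  have hBS : torusBall (n+1) L γ x₀ r ⊆ S := by
    intro x hx
    obtain ⟨v, hv⟩ := exists_lt_of_ciInf_lt (show torusDist (n+1) L γ x x₀ < r from hx)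
    have h0 := (PiLp.norm_apply_le (x - x₀ - ∑ i, (v i : ℝ) • latVec (n+1) L γ i) 0).trans hv.le
    have h1 : (x - x₀ - ∑ i, (v i : ℝ) • latVec (n+1) L γ i) 0 = x 0 - x₀ 0 - v 0 * L := by
      simp only [PiLp.sub_apply]
      congr 1
      simp [latVec, Finset.sum_apply, Pi.single_apply, hγ0]
    rw [h1, Real.norm_eq_abs] at h0
    have h2 : |θ (x 0 - v 0 * L)| ≤ 1/10 := by
      have : θ (x 0 - v 0 * L) = k * (x 0 - x₀ 0 - v 0 * L) := by simp only [hθ]; ring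
      rw [this, abs_mul, abs_of_pos hk0]
      exact (mul_le_mul_of_nonneg_left h0 hk0.le).trans hkr
    have h3 := trig_hi _ h2
    rw [cos_two_mul, ← hcosp, ← cos_two_mul] at h3
    simp only [hS, Set.mem_setOf_eq]
    exact h3
  have hmono : (∫ x in fund (n+1) L γ ∩ torusBall (n+1) L γ x₀ r, ‖Ψ x‖ ^ 2) ≤
      ∫ x in fund (n+1) L γ ∩ S, ‖Ψ x‖ ^ 2 := by
    refine setIntegral_mono_set (hui.mono_set Set.inter_subset_left) ?_ ?_
    · exact Filter.Eventually.of_forall fun x => by simp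
    · exact (Set.inter_subset_inter_right _ hBS).eventuallyLE
  refine hmono.trans_lt ?_
  have hind : ∫ x in fund (n+1) L γ ∩ S, ‖Ψ x‖ ^ 2 =
      ∫ x in fund (n+1) L γ, S.indicator (fun x => ‖Ψ x‖ ^ 2) x :=
    (setIntegral_indicator hSm).symm
  have hsi : IntegrableOn (S.indicator (fun x => ‖Ψ x‖ ^ 2)) (fund (n+1) L γ) :=
    hui.indicator hSm
  have hlow : ∫ x in fund (n+1) L γ, k ^ 2 * (2.2 * S.indicator (fun x => ‖Ψ x‖ ^ 2) x
      - 0.97 * ‖Ψ x‖ ^ 2) ≤ 0 := by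
    refine le_trans ?_ M
    refine setIntegral_mono_on ?_ ?_ (measurableSet_fund _ _ _) ?_
    · exact ((hsi.const_mul 2.2).sub (hui.const_mul 0.97)).const_mul _
    · apply cont_integrableOn_fund
      fun_prop
    · intro x _
      have hu0 : 0 ≤ ‖Ψ x‖ ^ 2 := by positivity
      have hP : 2 * E * (1 + cos (θ (x 0)) + cos (2 * θ (x 0)) / 8) ≤ 0.2125 * k ^ 2 := by
        have : 1 + cos (θ (x 0)) + cos (2 * θ (x 0)) / 8 ≤ 17/8 := by
          linarith [cos_le_one (θ (x 0)), cos_le_one (2 * θ (x 0))]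
        nlinarith
      have hk2 : 0 < k ^ 2 := by positivity
      by_cases hx : x ∈ S
      · rw [Set.indicator_of_mem hx]
        have hx' : 1.48 ≤ cos (θ (x 0)) + cos (2 * θ (x 0)) / 2 := hx
        have h5 : k ^ 2 * 1.23 ≤ - (- k ^ 2 * (cos (θ (x 0)) + cos (2 * θ (x 0)) / 2)) -
            2 * E * (1 + cos (θ (x 0)) + cos (2 * θ (x 0)) / 8) := by nlinarith
        have := mul_le_mul_of_nonneg_left h5 hu0
        calc _ = ‖Ψ x‖ ^ 2 * (k ^ 2 * 1.23) := by ring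
          _ ≤ _ := this
      · rw [Set.indicator_of_notMem hx]
        have hx' := trig_low (θ (x 0))
        have h5 : k ^ 2 * (-0.97) ≤ - (- k ^ 2 * (cos (θ (x 0)) + cos (2 * θ (x 0)) / 2)) -
            2 * E * (1 + cos (θ (x 0)) + cos (2 * θ (x 0)) / 8) := by nlinarith
        have := mul_le_mul_of_nonneg_left h5 hu0
        calc _ = ‖Ψ x‖ ^ 2 * (k ^ 2 * (-0.97)) := by ring
          _ ≤ _ := this
  rw [integral_const_mul, integral_sub (hsi.const_mul 2.2) (hui.const_mul 0.97),
    integral_const_mul, integral_const_mul, hnorm, ← hind] at hlow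
  have hk2 : 0 < k ^ 2 := by positivity
  have := nonpos_of_mul_nonpos_right hlow hk2
  linarith

/-- **Algebraic delocalization** (Theorem 2.1): there are absolute constants `c₁, c₂ > 0`
such that for `d ≤ 3`, `η ∈ (0, 1/(4-d))`, `c_V = c₁(1+‖V‖_∞^{1/2})^{-1/2}`, any
`L²`-normalized solution `Ψ` of `(-Δ+V)Ψ = EΨ` on `𝕋^d_L` with
`E ∈ [(2c_V/L)^{4/(1+dη)}, min(c_V^{4/(1+dη)}, c₂^{2/(dη)})]` and `L` sufficiently large
satisfies, for every `x₀ ∈ 𝕋^d_L`: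
`∫_{B(x₀, c_V E^{-1/4+η(1-d/4)})} |Ψ|² dμ < 1/2`  or
`∫_{𝕋^d_L ∖ B(x₀, c_V E^{-1/4-dη/4})} |Ψ|² dμ > E`. -/
theorem algebraic_delocalization :
    ∃ c₁ c₂ : ℝ, 0 < c₁ ∧ 0 < c₂ ∧
      ∀ (d : ℕ) (hd : 0 < d), d ≤ 3 →
      ∀ γ : Fin d → ℝ, (∀ i, 1 ≤ γ i) → γ ⟨0, hd⟩ = 1 →
      ∀ η : ℝ, 0 < η → η < 1 / (4 - (d : ℝ)) →
      ∀ Vsup : ℝ, 0 ≤ Vsup →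
      ∀ cV : ℝ, cV = c₁ * (1 + Vsup ^ ((1:ℝ)/2)) ^ (-(1:ℝ)/2) →
      ∃ L₀ : ℝ, 0 < L₀ ∧ ∀ L : ℝ, L₀ ≤ L →
      ∀ V : EuclideanSpace ℝ (Fin d) → ℝ,
        Measurable V → (∀ x, 0 ≤ V x) → (∀ x, V x ≤ Vsup) → LatPeriodic d L γ V →
      ∀ E : ℝ, 0 < E → E < 1 →
        (2 * cV / L) ^ ((4:ℝ) / (1 + d * η)) ≤ E →
        E ≤ min (cV ^ ((4:ℝ) / (1 + d * η))) (c₂ ^ ((2:ℝ) / (d * η))) →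
      ∀ Ψ : EuclideanSpace ℝ (Fin d) → ℂ, IsSolution d L γ V E Ψ →
      ∀ x₀ : EuclideanSpace ℝ (Fin d),
        (∫ x in fund d L γ ∩
            torusBall d L γ x₀ (cV * E ^ (-(1:ℝ)/4 + η * (1 - (d:ℝ)/4))),
            ‖Ψ x‖ ^ 2) < 1 / 2 ∨
        (∫ x in fund d L γ \
            torusBall d L γ x₀ (cV * E ^ (-(1:ℝ)/4 - (d:ℝ) * η / 4)),
            ‖Ψ x‖ ^ 2) > E := by
  refine ⟨1/100, 1/1000, by norm_num, by norm_num, ?_⟩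
  intro d hd hd3 γ hγ hγ0 η hη _ Vsup hVs cV hcV
  refine ⟨1, one_pos, ?_⟩
  intro L hL V _ hV _ _ E hE hE1 hElow hEup Ψ hΨ x₀
  left
  have hLpos : 0 < L := by linarith
  have hcVpos : 0 < cV := by rw [hcV]; positivity
  have hcVle : cV ≤ 1/100 := by
    rw [hcV]
    have h1 : (1 + Vsup ^ ((1:ℝ)/2)) ^ (-(1:ℝ)/2) ≤ 1 := by
      apply rpow_le_one_of_one_le_of_nonpos
      · have : 0 ≤ Vsup ^ ((1:ℝ)/2) := by positivity
        linarith
      · norm_num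
    linarith
  have hdR : (1:ℝ) ≤ d := by exact_mod_cast hd
  have hdR3 : (d:ℝ) ≤ 3 := by exact_mod_cast hd3
  have hdη : 0 < (d:ℝ) * η := by positivity
  set r := cV * E ^ (-(1:ℝ)/4 + η * (1 - (d:ℝ)/4)) with hr
  have hrpos : 0 < r := by positivity
  -- E^η is small
  have hEη : E ^ η ≤ 1/100 := by
    have h1 : E ≤ (1/1000 : ℝ) ^ ((2:ℝ) / (d * η)) := hEup.trans (min_le_right _ _)
    have h2 := rpow_le_rpow hE.le h1 hη.le
    rw [← rpow_mul (by norm_num)] at h2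
    have h3 : (2:ℝ) / (d * η) * η = 2 / d := by field_simp
    rw [h3] at h2
    refine h2.trans ?_
    have h4 : (1/1000 : ℝ) ^ ((2:ℝ) / d) ≤ (1/1000 : ℝ) ^ ((2:ℝ) / 3) := by
      apply rpow_le_rpow_of_exponent_ge (by norm_num) (by norm_num)
      gcongr
    refine h4.trans (le_of_eq ?_)
    rw [show (1/1000 : ℝ) = (1/10) ^ (3:ℝ) by norm_num, ← rpow_mul (by norm_num)]
    norm_num
  -- r / L is small
  have hrL : r ≤ L / 200 := by
    have h1 : 2 * cV / L ≤ E ^ ((1 + d * η) / 4) := by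
      have h2 := rpow_le_rpow (by positivity) hElow
        (show (0:ℝ) ≤ (1 + d * η) / 4 by positivity)
      rw [← rpow_mul (by positivity)] at h2
      have h3 : (4:ℝ) / (1 + d * η) * ((1 + d * η) / 4) = 1 := by field_simp
      rwa [h3, rpow_one] at h2
    have h2 : cV ≤ L / 2 * E ^ ((1 + d * η) / 4) := by
      rw [div_le_iff₀ hLpos] at h1; linarith
    have h3 : r ≤ L / 2 * E ^ η := by
      calc r ≤ L / 2 * E ^ ((1 + d * η) / 4) * E ^ (-(1:ℝ)/4 + η * (1 - (d:ℝ)/4)) := by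
            rw [hr]; gcongr
        _ = L / 2 * E ^ η := by
            rw [mul_assoc, ← rpow_add hE]; congr 2; ring
    nlinarith
  -- r √E is small
  have hrE : r * √E ≤ 1/100 := by
    have : r * √E = cV * E ^ ((1:ℝ)/4 + η * (1 - (d:ℝ)/4)) := by
      rw [hr, sqrt_eq_rpow, mul_assoc, ← rpow_add hE]; congr 2; ring
    rw [this]
    have h1 : E ^ ((1:ℝ)/4 + η * (1 - (d:ℝ)/4)) ≤ 1 := by
      apply rpow_le_one hE.le hE1.le
      have : 0 ≤ η * (1 - (d:ℝ)/4) := mul_nonneg hη.le (by linarith)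
      linarith
    nlinarith
  set N := ⌈5 * √E * L / (2 * π)⌉₊ with hN
  have hsE : 0 < √E := sqrt_pos.2 hE
  have hN1 : 5 * √E * L / (2 * π) ≤ N := Nat.le_ceil _
  have hN2 : (N:ℝ) < 5 * √E * L / (2 * π) + 1 := Nat.ceil_lt_add_one (by positivity)
  have hpi := pi_pos
  have hk1 : 5 * √E ≤ 2 * π * N / L := by
    rw [div_le_iff₀ (by positivity)] at hN1
    rw [le_div_iff₀ hLpos]; linarith
  have hk2 : 2 * π * N / L ≤ 5 * √E + 2 * π / L := by
    rw [← sub_lt_iff_lt_add, lt_div_iff₀ (by positivity)] at hN2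
    rw [div_le_iff₀ hLpos, add_mul, div_mul_cancel₀ _ hLpos.ne']; linarith
  obtain ⟨n, rfl⟩ : ∃ n, d = n + 1 := ⟨d - 1, by omega⟩
  refine core n L hLpos γ hγ hγ0 V hV E hE Ψ hΨ x₀ r N (2 * π * N / L)
    (by field_simp) (by linarith [mul_pos (show (0:ℝ) < 5 by norm_num) hsE]) ?_ ?_
  · have h1 := pow_le_pow_left₀ (by positivity) hk1 2
    rw [mul_pow, sq_sqrt hE.le] at h1
    linarith
  · have h1 := mul_le_mul_of_nonneg_right hk2 hrpos.le
    have h2 : 2 * π / L * r ≤ 2 * π / L * (L / 200) := by gcongr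
    have h3 : 2 * π / L * (L / 200) = π / 100 := by field_simp; norm_num
    have := pi_lt_four
    nlinarith
end
end

section
/- There is an absolute constant c > 0 such that the following holds. Let Ψ be a solution of (−Δ+V)Ψ = EΨ on 𝕋^d_L with ‖Ψ‖_{L²(𝕋^d_L)} = 1 and 0 < E < 1, let x₀ ∈ 𝕋^d_L and 1 ≤ r ≤ L/2, and suppose the localization bound ∫_{𝕋^d_L ∖ B(x₀,r)} |Ψ|² dμ ≤ E holds. Then for all x₁, x₂ ∈ B(x₀, r): |Ψ(x₁) − Ψ(x₂)| ≤ c · r^{(4−d)/2} · (1 + ‖V‖_∞^{1/2}) · E^{1/2}. -/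
open MeasureTheory Real Filter

noncomputable section

abbrev muT (d : ℕ) : Measure (UnitAddTorus (Fin d)) :=
  Measure.pi (fun _ => (AddCircle.haarAddCircle : Measure UnitAddCircle))

lemma muT_def (d : ℕ) (f : UnitAddTorus (Fin d) → ℂ) (n : Fin d → ℤ) :
    UnitAddTorus.mFourierCoeff f n = ∫ t, UnitAddTorus.mFourier (-n) t * f t ∂(muT d) := rfl

lemma muT_preimage {E : Type*} [NormedAddCommGroup E] [NormedSpace ℝ E] (d : ℕ)
    (f : UnitAddTorus (Fin d) → E) :
    ∫ t, f t ∂(muT d) =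
      ∫ (x : Fin d → ℝ) in {x : Fin d → ℝ | ∀ i, x i ∈ Set.Ioc (0:ℝ) 1},
        f (fun i => (x i : UnitAddCircle)) := by
  have := UnitAddTorus.integral_preimage f 0
  simp only [Pi.zero_apply, zero_add] at this
  exact this

lemma coeff_toLp (d : ℕ) (F : C(UnitAddTorus (Fin d), ℂ)) (n : Fin d → ℤ) :
    UnitAddTorus.mFourierCoeff (F.toLp 2 (muT d) ℂ) n = UnitAddTorus.mFourierCoeff F n :=
  UnitAddTorus.mFourierCoeff_toLp F n

lemma hasSum_cg {ι α : Type*} [AddCommMonoid α] [TopologicalSpace α] {f g : ι → α} {a b : α}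
    (h : HasSum f a) (hfg : ∀ i, g i = f i) (hab : b = a) : HasSum g b := by
  rw [hab, funext hfg]; exact h

lemma parseval_inner (d : ℕ) (F G : C(UnitAddTorus (Fin d), ℂ)) :
    HasSum (fun n => (starRingEnd ℂ) (UnitAddTorus.mFourierCoeff F n) *
      UnitAddTorus.mFourierCoeff G n) (∫ t, (starRingEnd ℂ) (F t) * G t ∂(muT d)) := by
  have h := UnitAddTorus.hasSum_prod_mFourierCoeff (F.toLp 2 (muT d) ℂ) (G.toLp 2 (muT d) ℂ)
  refine hasSum_cg h (fun n => ?_) ?_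
  · rw [← coeff_toLp, ← coeff_toLp]
  apply integral_congr_ae
  filter_upwards [F.coeFn_toLp (p := 2) (𝕜 := ℂ) (muT d), G.coeFn_toLp (p := 2) (𝕜 := ℂ) (muT d)] with t h1 h2
  rw [h1, h2]

lemma parseval_sq (d : ℕ) (F : C(UnitAddTorus (Fin d), ℂ)) :
    HasSum (fun n => ‖UnitAddTorus.mFourierCoeff F n‖ ^ 2) (∫ t, ‖F t‖ ^ 2 ∂(muT d)) := by
  have h := UnitAddTorus.hasSum_sq_mFourierCoeff (F.toLp 2 (muT d) ℂ)
  refine hasSum_cg h (fun n => ?_) ?_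
  · rw [← coeff_toLp]
  apply integral_congr_ae
  filter_upwards [F.coeFn_toLp (p := 2) (𝕜 := ℂ) (muT d)] with t h1
  rw [h1]

lemma muT_integrable {E : Type*} [NormedAddCommGroup E] (d : ℕ)
    (f : UnitAddTorus (Fin d) → E) (hf : Continuous f) : Integrable f (muT d) := by
  rw [← integrableOn_univ]
  exact hf.continuousOn.integrableOn_compact isCompact_univ

/-- directional derivative on the torus -/
def HasPD {d : ℕ} (i : Fin d) (F F' : UnitAddTorus (Fin d) → ℂ) : Prop :=
  ∀ t, HasDerivAt (fun s : ℝ => F (t + Pi.single i (s : UnitAddCircle))) (F' t) 0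

lemma HasPD.at {d : ℕ} {i : Fin d} {F F' : UnitAddTorus (Fin d) → ℂ} (h : HasPD i F F')
    (t : UnitAddTorus (Fin d)) (s : ℝ) :
    HasDerivAt (fun s : ℝ => F (t + Pi.single i (s : UnitAddCircle)))
      (F' (t + Pi.single i (s : UnitAddCircle))) s := by
  have h1 := h (t + Pi.single i (s : UnitAddCircle))
  rw [← sub_self s] at h1
  have := HasDerivAt.comp_sub_const s s h1
  have e : (fun s : ℝ => F (t + Pi.single i (s : UnitAddCircle))) =
      (fun x : ℝ => F (t + Pi.single i (s : UnitAddCircle) +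
        Pi.single i ((x - s : ℝ) : UnitAddCircle))) := by
    funext u
    rw [add_assoc, ← Pi.single_add, ← AddCircle.coe_add]
    congr 3; simp
  rw [e]
  exact this

lemma integral_pd_zero {d : ℕ} {i : Fin d} {F F' : UnitAddTorus (Fin d) → ℂ} (h : HasPD i F F')
    (hF' : Continuous F') : ∫ t, F' t ∂(muT d) = 0 := by
  have hsw : ∫ s in (0:ℝ)..1, ∫ t, F' (t + Pi.single i (s : UnitAddCircle)) ∂(muT d)
      = ∫ t, (∫ s in (0:ℝ)..1, F' (t + Pi.single i (s : UnitAddCircle))) ∂(muT d) := by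
    simp only [intervalIntegral.integral_of_le zero_le_one]
    apply MeasureTheory.integral_integral_swap
    have hc : Continuous (Function.uncurry fun (s : ℝ) (t : UnitAddTorus (Fin d)) =>
        F' (t + Pi.single i (s : UnitAddCircle))) := by
      have h1 : Continuous (fun s : ℝ => (s : UnitAddCircle)) := AddCircle.continuous_mk' 1
      have h2 : Continuous (fun s : UnitAddCircle => (Pi.single i s : UnitAddTorus (Fin d))) :=
        continuous_single (A := fun _ : Fin d => UnitAddCircle) i
      simp only [Function.uncurry_def]
      exact hF'.comp (continuous_snd.add ((h2.comp h1).comp continuous_fst))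
    obtain ⟨C, hC⟩ := (isCompact_univ (X := UnitAddTorus (Fin d))).exists_bound_of_continuousOn hF'.continuousOn
    refine Integrable.of_bound (C := C) hc.aestronglyMeasurable ?_
    exact Eventually.of_forall fun p => hC _ trivial
  have h1 : ∀ s : ℝ, ∫ t, F' (t + Pi.single i (s : UnitAddCircle)) ∂(muT d) = ∫ t, F' t ∂(muT d) :=
    fun s => integral_add_right_eq_self F' _
  have h2 : ∀ t : UnitAddTorus (Fin d), ∫ s in (0:ℝ)..1, F' (t + Pi.single i (s : UnitAddCircle)) = 0 := by
    intro t
    rw [intervalIntegral.integral_eq_sub_of_hasDerivAt (fun s _ => h.at t s)]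
    · have : ((1:ℝ) : UnitAddCircle) = 0 := AddCircle.coe_period 1
      simp [this]
    · apply Continuous.intervalIntegrable
      have h1 : Continuous (fun s : ℝ => (s : UnitAddCircle)) := AddCircle.continuous_mk' 1
      have h2 : Continuous (fun s : UnitAddCircle => (Pi.single i s : UnitAddTorus (Fin d))) :=
        continuous_single (A := fun _ : Fin d => UnitAddCircle) i
      exact hF'.comp (continuous_const.add (h2.comp h1))
  simp only [h1, h2] at hsw
  simpa using hsw

lemma mFourier_pd {d : ℕ} (i : Fin d) (n : Fin d → ℤ) :
    HasPD i (UnitAddTorus.mFourier n)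
      (fun t => 2 * π * Complex.I * n i * UnitAddTorus.mFourier n t) := by
  intro t
  have h0 : ∀ s : ℝ, UnitAddTorus.mFourier n (t + Pi.single i (s : UnitAddCircle)) =
      fourier (n i) (s : UnitAddCircle) * UnitAddTorus.mFourier n t := by
    intro s
    simp only [UnitAddTorus.mFourier, ContinuousMap.coe_mk]
    rw [← Finset.mul_prod_erase _ _ (Finset.mem_univ i), ← Finset.mul_prod_erase (a := i) _ (fun i => (fourier (n i)) (t i)) (Finset.mem_univ i), ← mul_assoc]
    congr 1
    · simp only [Pi.add_apply, Pi.single_eq_same, fourier_apply, smul_add, AddCircle.toCircle_add]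
      push_cast; ring
    · apply Finset.prod_congr rfl
      intro j hj
      simp [Pi.single_eq_of_ne (Finset.ne_of_mem_erase hj)]
  simp only [h0]
  have := (hasDerivAt_fourier 1 (n i) 0).mul_const (UnitAddTorus.mFourier n t)
  refine this.congr_deriv ?_
  simp

lemma coeff_pd {d : ℕ} {i : Fin d} {F F' : UnitAddTorus (Fin d) → ℂ} (h : HasPD i F F')
    (hF : Continuous F) (hF' : Continuous F') (n : Fin d → ℤ) :
    UnitAddTorus.mFourierCoeff F' n = 2 * π * Complex.I * n i * UnitAddTorus.mFourierCoeff F n := by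
  have hm := mFourier_pd i (-n)
  have hp : HasPD i (fun t => UnitAddTorus.mFourier (-n) t * F t) (fun t =>
      (2 * π * Complex.I * (-n) i * UnitAddTorus.mFourier (-n) t) * F t +
        UnitAddTorus.mFourier (-n) t * F' t) := by
    intro t
    refine ((hm t).mul (h t)).congr_deriv ?_
    simp
  have hc := (UnitAddTorus.mFourier (-n)).continuous
  have := integral_pd_zero hp (by fun_prop)
  rw [integral_add (muT_integrable _ _ (by fun_prop)) (muT_integrable _ _ (by fun_prop))] at this
  rw [muT_def, muT_def, ← integral_const_mul, eq_comm, ← sub_eq_zero, ← neg_eq_zero, ← this]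
  rw [neg_sub, sub_eq_neg_add, ← integral_neg]
  congr 2
  ext t; simp; ring

def bet (x : ℝ) : ℝ := ((1 + x) ^ ((1:ℝ)/3))⁻¹

lemma bet_pos {x : ℝ} (hx : 0 ≤ x) : 0 < bet x := by unfold bet; positivity

lemma bet_cube {x : ℝ} (hx : 0 ≤ x) : bet x ^ 3 * (1 + x) = 1 := by
  unfold bet
  have : ((1 + x) ^ ((1:ℝ)/3)) ^ 3 = 1 + x := by
    rw [← Real.rpow_natCast, ← Real.rpow_mul (by positivity)]; norm_num
  rw [inv_pow, this]; field_simp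

lemma bet_zero : bet 0 = 1 := by simp [bet]

lemma bet_tel {x h : ℝ} (hx : 0 ≤ x) (hh : 0 ≤ h) :
    h * bet (x + h) ^ 4 ≤ 3 * (bet x - bet (x + h)) := by
  have ha := bet_pos hx
  have hb := bet_pos (add_nonneg hx hh)
  have ca := bet_cube hx
  have cb := bet_cube (add_nonneg hx hh)
  set a := bet x
  set b := bet (x + h)
  have hba : b ≤ a := by
    have : b ^ 3 ≤ a ^ 3 := by
      have e1 : b ^ 3 * (1 + x) ≤ b ^ 3 * (1 + (x + h)) := by gcongr; linarith
      have : 0 < 1 + x := by linarith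
      nlinarith
    exact le_of_pow_le_pow_left₀ (by norm_num) ha.le this
  have e : h * (a ^ 3 * b ^ 3) = (a - b) * (a ^ 2 + a * b + b ^ 2) := by
    have : h * (a ^ 3 * b ^ 3) = a ^ 3 * (b ^ 3 * (1 + (x + h))) - b ^ 3 * (a ^ 3 * (1 + x)) := by ring
    rw [this, ca, cb]; ring
  have e2 : h * b ^ 4 * a ^ 3 ≤ 3 * (a - b) * a ^ 3 := by
    have : h * b ^ 4 * a ^ 3 = (a - b) * ((a ^ 2 + a * b + b ^ 2) * b) := by
      rw [show h * b ^ 4 * a ^ 3 = h * (a ^ 3 * b ^ 3) * b by ring, e]; ring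
    rw [this, show 3 * (a - b) * a ^ 3 = (a - b) * (3 * a ^ 3) by ring]
    apply mul_le_mul_of_nonneg_left _ (by linarith)
    have h1 : a ^ 2 + a * b + b ^ 2 ≤ 3 * a ^ 2 := by nlinarith
    calc _ ≤ 3 * a ^ 2 * a := by gcongr
      _ = _ := by ring
  exact le_of_mul_le_mul_right e2 (by positivity)

lemma bet_sum_nat {h : ℝ} (hh : 0 ≤ h) (N : ℕ) :
    h * ∑ m ∈ Finset.range (N + 1), bet (h * m) ^ 4 ≤ h + 3 * (1 - bet (h * N)) := by
  induction N with
  | zero => simp [bet_zero]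
  | succ N ih =>
    rw [Finset.sum_range_succ, mul_add]
    have := bet_tel (x := h * N) (by positivity) hh
    have e : h * ((N + 1 : ℕ) : ℝ) = h * N + h := by push_cast; ring
    rw [e]
    linarith

lemma bet_sum_int {h : ℝ} (hh : 0 ≤ h) (N : ℕ) :
    h * ∑ m ∈ Finset.Icc (-(N:ℤ)) N, bet (h * |(m:ℝ)|) ^ 4 ≤ h + 6 := by
  have he : Function.Even (fun m : ℤ => bet (h * |(m:ℝ)|) ^ 4) := by intro m; simp
  rw [Finset.sum_Icc_of_even_eq_range he]
  have := bet_sum_nat hh N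
  have hb := bet_pos (x := h * N) (by positivity)
  simp only [Int.cast_natCast, Nat.abs_cast, Int.cast_zero, abs_zero, mul_zero, bet_zero] 
  simp only [nsmul_eq_mul]
  push_cast
  nlinarith

lemma bet_prod {d : ℕ} (hd : d ≤ 3) (u : Fin d → ℝ) :
    1 / (1 + ∑ i, u i ^ 2) ^ 2 ≤ 4 * ∏ i, bet |u i| ^ 4 := by
  set q := 1 + ∑ i, u i ^ 2 with hq
  have hs : 0 ≤ ∑ i, u i ^ 2 := Finset.sum_nonneg fun i _ => sq_nonneg _
  have hq1 : 1 ≤ q := by linarith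
  set p := ∏ i, bet |u i| ^ 4 with hp
  have hp0 : 0 < p := Finset.prod_pos fun i _ => pow_pos (bet_pos (abs_nonneg _)) _
  have h1 : p ^ 3 * ∏ i, (1 + |u i|) ^ 4 = 1 := by
    rw [hp, ← Finset.prod_pow, ← Finset.prod_mul_distrib]
    apply Finset.prod_eq_one
    intro i _
    rw [show (bet |u i| ^ 4) ^ 3 * (1 + |u i|) ^ 4 = (bet |u i| ^ 3 * (1 + |u i|)) ^ 4 by ring,
      bet_cube (abs_nonneg _), one_pow]
  have h2 : ∏ i, (1 + |u i|) ^ 4 ≤ (4 * q ^ 2) ^ 3 := by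
    calc ∏ i, (1 + |u i|) ^ 4 ≤ ∏ i : Fin d, (4 * q ^ 2) := by
          apply Finset.prod_le_prod (fun i _ => by positivity)
          intro i _
          have hi : u i ^ 2 ≤ ∑ i, u i ^ 2 :=
            Finset.single_le_sum (f := fun i => u i ^ 2) (fun i _ => sq_nonneg _) (Finset.mem_univ i)
          have h3 : (1 + |u i|) ^ 2 ≤ 2 * q := by
            have := sq_abs (u i)
            nlinarith [sq_nonneg (1 - |u i|)]
          calc (1 + |u i|) ^ 4 = ((1 + |u i|) ^ 2) ^ 2 := by ring
            _ ≤ (2 * q) ^ 2 := by gcongr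
            _ = _ := by ring
      _ = (4 * q ^ 2) ^ d := by simp
      _ ≤ _ := pow_le_pow_right₀ (by nlinarith) hd
  have h3 : 1 ^ 3 ≤ (p * (4 * q ^ 2)) ^ 3 := by
    rw [one_pow, ← h1, mul_pow]; gcongr
  have h4 := le_of_pow_le_pow_left₀ (by norm_num) (by positivity) h3
  rw [div_le_iff₀ (by positivity)]
  linarith

lemma lattice_sum {d : ℕ} (hd : d ≤ 3) (l : Fin d → ℝ) (r : ℝ) (hr : 0 < r) (hl : ∀ i, 2 * r ≤ l i)
    (s : Finset (Fin d → ℤ)) :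
    ∑ n ∈ s, 1 / (1 + ∑ i, (2 * π * r * n i / l i) ^ 2) ^ 2 ≤ 32 * (∏ i, l i) / r ^ d := by
  obtain ⟨N, hN⟩ : ∃ N : ℕ, s ⊆ Fintype.piFinset (fun _ : Fin d => Finset.Icc (-(N:ℤ)) N) := by
    refine ⟨s.sup (fun n => Finset.univ.sup fun i => (n i).natAbs), fun n hn => ?_⟩
    rw [Fintype.mem_piFinset]
    intro i
    have h1 : (n i).natAbs ≤ Finset.univ.sup fun i => (n i).natAbs :=
      Finset.le_sup (f := fun i => (n i).natAbs) (Finset.mem_univ i)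
    have h2 := Finset.le_sup (f := fun n : Fin d → ℤ => Finset.univ.sup fun i => (n i).natAbs) hn
    rw [Finset.mem_Icc]
    omega
  have hlp : ∀ i, 0 < l i := fun i => by linarith [hl i]
  calc _ ≤ ∑ n ∈ s, 4 * ∏ i, bet (2 * π * r / l i * |(n i : ℝ)|) ^ 4 := by
        apply Finset.sum_le_sum
        intro n _
        refine (bet_prod hd _).trans_eq ?_
        congr 1
        apply Finset.prod_congr rfl
        intro i _
        have := hlp i
        have e : 2 * π * r * n i / l i = 2 * π * r / l i * n i := by ring
        rw [e, abs_mul, abs_of_pos (a := 2 * π * r / l i) (by positivity)]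
    _ ≤ ∑ n ∈ Fintype.piFinset (fun _ : Fin d => Finset.Icc (-(N:ℤ)) N),
          4 * ∏ i, bet (2 * π * r / l i * |(n i : ℝ)|) ^ 4 := by
        apply Finset.sum_le_sum_of_subset_of_nonneg hN
        intro n _ _
        have : 0 ≤ ∏ i, bet (2 * π * r / l i * |(n i : ℝ)|) ^ 4 :=
          Finset.prod_nonneg fun i _ => by positivity
        positivity
    _ = 4 * ∏ i, ∑ m ∈ Finset.Icc (-(N:ℤ)) N, bet (2 * π * r / l i * |(m : ℝ)|) ^ 4 := by
        rw [← Finset.mul_sum, Finset.prod_univ_sum]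
    _ ≤ 4 * ∏ i, (2 * l i / r) := by
        gcongr with i
        have h0 := hlp i
        have hh : 0 < 2 * π * r / l i := by positivity
        have h1 := bet_sum_int hh.le N
        set S := ∑ m ∈ Finset.Icc (-(N:ℤ)) N, bet (2 * π * r / l i * |(m : ℝ)|) ^ 4
        have h2 : 2 * π * r / l i ≤ π := by
          rw [div_le_iff₀ h0]; nlinarith [hl i, pi_pos]
        have h3 : 2 * π * r / l i * S ≤ 4 * π := by linarith [pi_gt_three]
        rw [div_mul_eq_mul_div, div_le_iff₀ h0] at h3
        rw [le_div_iff₀ hr]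
        have : 2 * π * (S * r) ≤ 2 * π * (2 * l i) := by linarith
        exact le_of_mul_le_mul_left this (by positivity)
    _ = 4 * 2 ^ d * (∏ i, l i) / r ^ d := by
        rw [Finset.prod_div_distrib, Finset.prod_mul_distrib]; simp; ring
    _ ≤ _ := by
        have h1 : (2:ℝ) ^ d ≤ 2 ^ 3 := pow_le_pow_right₀ (by norm_num) hd
        have h2 : 0 < ∏ i, l i := Finset.prod_pos fun i _ => hlp i
        gcongr
        linarith

lemma cs_tsum {ι : Type*} (a b : ι → ℝ) (ha : ∀ i, 0 ≤ a i) (hb : ∀ i, 0 ≤ b i) {A B : ℝ}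
    (hA : Summable fun i => a i ^ 2) (hB : Summable fun i => b i ^ 2)
    (hA' : ∑' i, a i ^ 2 ≤ A) (hB' : ∑' i, b i ^ 2 ≤ B) :
    (Summable fun i => a i * b i) ∧ (∑' i, a i * b i) ^ 2 ≤ A * B := by
  have h := Real.summable_and_inner_le_Lp_mul_Lq_tsum_of_nonneg Real.HolderConjugate.two_two
    ha hb (by simpa using hA) (by simpa using hB)
  refine ⟨h.1, ?_⟩
  have h2 := h.2
  simp only [Real.rpow_two, ← Real.sqrt_eq_rpow] at h2
  have hA0 : 0 ≤ ∑' i, a i ^ 2 := tsum_nonneg fun i => sq_nonneg _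
  have hB0 : 0 ≤ ∑' i, b i ^ 2 := tsum_nonneg fun i => sq_nonneg _
  have h0 : 0 ≤ ∑' i, a i * b i := tsum_nonneg fun i => mul_nonneg (ha i) (hb i)
  calc (∑' i, a i * b i) ^ 2 ≤ (√(∑' i, a i ^ 2) * √(∑' i, b i ^ 2)) ^ 2 := by gcongr
    _ = (∑' i, a i ^ 2) * (∑' i, b i ^ 2) := by
      rw [mul_pow, Real.sq_sqrt hA0, Real.sq_sqrt hB0]
    _ ≤ A * B := by gcongr; linarith

lemma torus_energy {d : ℕ} (κ : (Fin d → ℤ) → ℝ) (F G : C(UnitAddTorus (Fin d), ℂ))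
    (hFG : ∀ n, UnitAddTorus.mFourierCoeff G n = -(κ n : ℂ) * UnitAddTorus.mFourierCoeff F n)
    (hκ : ∀ n, 0 ≤ κ n)
    (W : UnitAddTorus (Fin d) → ℝ) (Vs E : ℝ) (hE : 0 < E) (hE1 : E < 1)
    (hW0 : ∀ t, 0 ≤ W t) (hW1 : ∀ t, W t ≤ Vs)
    (hG : ∀ t, G t = ((W t - E : ℝ) : ℂ) * F t) (P : ℝ) (hP : ∫ t, ‖F t‖ ^ 2 ∂(muT d) = P) :
    (Summable fun n => κ n * ‖UnitAddTorus.mFourierCoeff F n‖ ^ 2) ∧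
    (∑' n, κ n * ‖UnitAddTorus.mFourierCoeff F n‖ ^ 2 ≤ E * P) ∧
    (Summable fun n => κ n ^ 2 * ‖UnitAddTorus.mFourierCoeff F n‖ ^ 2) ∧
    (∑' n, κ n ^ 2 * ‖UnitAddTorus.mFourierCoeff F n‖ ^ 2 ≤ E * (1 + Vs) * P) := by
  have hFc := F.continuous
  have hGc := G.continuous
  have h1 := Complex.hasSum_re (parseval_inner d F G)
  have e1 : (∫ t, (starRingEnd ℂ) (F t) * G t ∂(muT d)).re =
      ∫ t, ((starRingEnd ℂ) (F t) * G t).re ∂(muT d) := by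
    have := integral_re (𝕜 := ℂ) (muT_integrable d (fun t => (starRingEnd ℂ) (F t) * G t) (by fun_prop))
    exact this.symm
  have ept : ∀ t, ((starRingEnd ℂ) (F t) * G t).re = (W t - E) * ‖F t‖ ^ 2 := by
    intro t
    rw [hG, mul_left_comm, Complex.conj_mul', ← Complex.ofReal_pow, ← Complex.ofReal_mul, Complex.ofReal_re]
  have hcW : Continuous fun t => (W t - E) * ‖F t‖ ^ 2 := by
    simp only [← ept]; fun_prop
  simp only [ept] at e1
  rw [e1] at h1
  set J := ∫ t, (W t - E) * ‖F t‖ ^ 2 ∂(muT d) with hJ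
  have h1' : HasSum (fun n => κ n * ‖UnitAddTorus.mFourierCoeff F n‖ ^ 2) (-J) := by
    refine hasSum_cg h1.neg (fun n => ?_) rfl
    rw [hFG, mul_left_comm, Complex.conj_mul', ← Complex.ofReal_pow, ← Complex.ofReal_neg, ← Complex.ofReal_mul, Complex.ofReal_re]
    ring
  have h2 : HasSum (fun n => κ n ^ 2 * ‖UnitAddTorus.mFourierCoeff F n‖ ^ 2)
      (∫ t, ‖G t‖ ^ 2 ∂(muT d)) := by
    refine hasSum_cg (parseval_sq d G) (fun n => ?_) rfl
    rw [hFG, norm_mul, mul_pow, norm_neg, Complex.norm_real, Real.norm_eq_abs, sq_abs]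
  have hJ0 : 0 ≤ -J := h1'.nonneg fun n => mul_nonneg (hκ n) (sq_nonneg _)
  have hiF : Integrable (fun t => ‖F t‖ ^ 2) (muT d) := muT_integrable d _ (by fun_prop)
  have hiW : Integrable (fun t => (W t - E) * ‖F t‖ ^ 2) (muT d) := muT_integrable d _ hcW
  have hiG : Integrable (fun t => ‖G t‖ ^ 2) (muT d) := muT_integrable d _ (by fun_prop)
  have hVs : 0 ≤ Vs := (hW0 0).trans (hW1 0)
  have hP0 : 0 ≤ P := by rw [← hP]; positivity
  refine ⟨h1'.summable, ?_, h2.summable, ?_⟩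
  · rw [h1'.tsum_eq]
    have : ∫ t, -E * ‖F t‖ ^ 2 ∂(muT d) ≤ J := by
      apply integral_mono (hiF.const_mul _) hiW
      intro t
      have := hW0 t
      simp only
      gcongr
      linarith
    rw [integral_const_mul, hP] at this
    linarith
  · rw [h2.tsum_eq]
    have : ∫ t, ‖G t‖ ^ 2 ∂(muT d) ≤
        ∫ t, (Vs * ((W t - E) * ‖F t‖ ^ 2) + (Vs * E + E ^ 2) * ‖F t‖ ^ 2) ∂(muT d) := by
      apply integral_mono hiG ((hiW.const_mul _).add (hiF.const_mul _))
      intro t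
      have h3 := hW0 t
      have h4 := hW1 t
      change ‖G t‖ ^ 2 ≤ Vs * ((W t - E) * ‖F t‖ ^ 2) + (Vs * E + E ^ 2) * ‖F t‖ ^ 2
      rw [hG, norm_mul, mul_pow, Complex.norm_real, Real.norm_eq_abs, sq_abs, ← mul_assoc, ← add_mul]
      gcongr
      nlinarith
    rw [integral_add (hiW.const_mul _) (hiF.const_mul _), integral_const_mul, integral_const_mul, hP] at this
    have h5 : Vs * J ≤ 0 := by nlinarith
    have h6 : E ^ 2 * P ≤ E * P := by
      gcongr; nlinarith
    calc _ ≤ (Vs * E + E ^ 2) * P := by linarith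
      _ ≤ _ := by linarith

lemma mFourier_norm_apply {d : ℕ} (n : Fin d → ℤ) (t : UnitAddTorus (Fin d)) :
    ‖UnitAddTorus.mFourier n t‖ = 1 := by
  simp [UnitAddTorus.mFourier, fourier_apply, Circle.norm_coe]

lemma torus_main {d : ℕ} (hd : d ≤ 3) (l : Fin d → ℝ) (r : ℝ) (hr : 1 ≤ r) (hl : ∀ i, 2 * r ≤ l i)
    (F G : C(UnitAddTorus (Fin d), ℂ))
    (hFG : ∀ n, UnitAddTorus.mFourierCoeff G n =
      -((∑ i, (2 * π * n i / l i) ^ 2 : ℝ) : ℂ) * UnitAddTorus.mFourierCoeff F n)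
    (W : UnitAddTorus (Fin d) → ℝ) (Vs E : ℝ) (hE : 0 < E) (hE1 : E < 1)
    (hW0 : ∀ t, 0 ≤ W t) (hW1 : ∀ t, W t ≤ Vs)
    (hG : ∀ t, G t = ((W t - E : ℝ) : ℂ) * F t)
    (hP : (∏ i, l i) * ∫ t, ‖F t‖ ^ 2 ∂(muT d) = 1)
    (t₁ t₂ : UnitAddTorus (Fin d))
    (ht : ∀ n : Fin d → ℤ, ‖UnitAddTorus.mFourier n t₁ - UnitAddTorus.mFourier n t₂‖ ^ 2 ≤
      4 * r ^ 2 * ∑ i, (2 * π * n i / l i) ^ 2) :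
    ‖F t₁ - F t₂‖ ^ 2 ≤ 512 * (r ^ 4 / r ^ d) * (1 + Vs) * E := by
  set κ : (Fin d → ℤ) → ℝ := fun n => ∑ i, (2 * π * n i / l i) ^ 2 with hκ
  have hr0 : 0 < r := by linarith
  have hκ0 : ∀ n, 0 ≤ κ n := fun n => Finset.sum_nonneg fun i _ => sq_nonneg _
  have hVs : 0 ≤ Vs := (hW0 0).trans (hW1 0)
  have hlP : 0 < ∏ i, l i := Finset.prod_pos fun i _ => by linarith [hl i]
  set P := ∫ t, ‖F t‖ ^ 2 ∂(muT d) with hPdef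
  have hP0 : 0 ≤ P := by positivity
  obtain ⟨s1, b1, s2, b2⟩ := torus_energy κ F G hFG hκ0 W Vs E hE hE1 hW0 hW1 hG P rfl
  set c : (Fin d → ℤ) → ℝ := fun n => ‖UnitAddTorus.mFourierCoeff F n‖ with hc
  have hc0 : ∀ n, 0 ≤ c n := fun n => norm_nonneg _
  -- b
  set b : (Fin d → ℤ) → ℝ := fun n => 1 / (1 + r ^ 2 * κ n) with hb
  have hq : ∀ n, 0 < 1 + r ^ 2 * κ n := fun n => by have := hκ0 n; positivity
  have hb0 : ∀ n, 0 ≤ b n := fun n => by have := hq n; positivity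
  have hbsum : ∀ s : Finset (Fin d → ℤ), ∑ n ∈ s, b n ^ 2 ≤ 32 * (∏ i, l i) / r ^ d := by
    intro s
    refine (Finset.sum_le_sum fun n _ => le_of_eq ?_).trans (lattice_sum hd l r hr0 hl s)
    simp only [hb, hκ, div_pow, one_pow]
    congr 3
    rw [Finset.mul_sum]
    refine Finset.sum_congr rfl fun i _ => ?_
    ring
  have sb : Summable fun n => b n ^ 2 := summable_of_sum_le (fun n => sq_nonneg _) hbsum
  have tb : ∑' n, b n ^ 2 ≤ 32 * (∏ i, l i) / r ^ d := sb.tsum_le_of_sum_le hbsum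
  -- a
  set a : (Fin d → ℤ) → ℝ := fun n => c n * √(r ^ 2 * κ n * (1 + r ^ 2 * κ n)) with ha
  have ha0 : ∀ n, 0 ≤ a n := fun n => mul_nonneg (hc0 n) (Real.sqrt_nonneg _)
  have hasq : ∀ n, a n ^ 2 = r ^ 2 * (κ n * c n ^ 2) + r ^ 4 * (κ n ^ 2 * c n ^ 2) := by
    intro n
    have := hκ0 n
    simp only [ha]
    rw [mul_pow, Real.sq_sqrt (by positivity)]; ring
  have sa : Summable fun n => a n ^ 2 := by
    simp only [hasq]
    exact (s1.mul_left _).add (s2.mul_left _)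
  have ta : ∑' n, a n ^ 2 ≤ 2 * r ^ 4 * (E * (1 + Vs) * P) := by
    simp only [hasq]
    rw [(s1.mul_left _).tsum_add (s2.mul_left _), tsum_mul_left, tsum_mul_left]
    have h1 : r ^ 2 * ∑' n, κ n * c n ^ 2 ≤ r ^ 4 * (E * (1 + Vs) * P) := by
      have h2 : r ^ 2 ≤ r ^ 4 := pow_le_pow_right₀ hr (by norm_num)
      have h3 : E * P ≤ E * (1 + Vs) * P := by
        have : 0 ≤ E * Vs * P := by positivity
        linarith
      have := hκ0
      calc _ ≤ r ^ 2 * (E * (1 + Vs) * P) := by gcongr; linarith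
        _ ≤ _ := by gcongr
    have h4 : r ^ 4 * ∑' n, κ n ^ 2 * c n ^ 2 ≤ r ^ 4 * (E * (1 + Vs) * P) := by gcongr
    linarith
  obtain ⟨sab, tab⟩ := cs_tsum a b ha0 hb0 sa sb ta tb
  -- summability of coefficients
  have sc2 : Summable fun n => c n ^ 2 := (parseval_sq d F).summable
  have sc : Summable c := by
    have := (cs_tsum (fun n => c n * (1 + r ^ 2 * κ n)) b (fun n => mul_nonneg (hc0 n) (hq n).le) hb0
      (A := ∑' n, (c n * (1 + r ^ 2 * κ n)) ^ 2) ?_ sb le_rfl tb).1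
    · refine this.congr fun n => ?_
      have := (hq n).ne'
      simp only [hb]; field_simp
    · refine ((sc2.add ((s1.mul_left (2 * r ^ 2)).add (s2.mul_left (r ^ 4))))).congr fun n => ?_
      ring
  have sF : Summable (UnitAddTorus.mFourierCoeff F) := Summable.of_norm sc
  have H1 := UnitAddTorus.hasSum_mFourier_series_apply_of_summable sF t₁
  have H2 := UnitAddTorus.hasSum_mFourier_series_apply_of_summable sF t₂
  have H := H1.sub H2
  have key : ∀ n, ‖UnitAddTorus.mFourierCoeff F n • UnitAddTorus.mFourier n t₁ -
      UnitAddTorus.mFourierCoeff F n • UnitAddTorus.mFourier n t₂‖ ≤ √8 * (a n * b n) := by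
    intro n
    rw [← smul_sub, norm_smul]
    have hθ : ‖UnitAddTorus.mFourier n t₁ - UnitAddTorus.mFourier n t₂‖ ≤
        √8 * (√(r ^ 2 * κ n * (1 + r ^ 2 * κ n)) * b n) := by
      have hk := hκ0 n
      have hx : 0 ≤ r ^ 2 * κ n := by positivity
      have hth := ht n
      have h4 : ‖UnitAddTorus.mFourier n t₁ - UnitAddTorus.mFourier n t₂‖ ^ 2 ≤ 4 := by
        have := norm_sub_le (UnitAddTorus.mFourier n t₁) (UnitAddTorus.mFourier n t₂)
        rw [mFourier_norm_apply, mFourier_norm_apply] at this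
        nlinarith [norm_nonneg (UnitAddTorus.mFourier n t₁ - UnitAddTorus.mFourier n t₂)]
      have hbn := hb0 n
      refine le_of_pow_le_pow_left₀ two_ne_zero (by positivity) ?_
      rw [mul_pow, mul_pow, Real.sq_sqrt (by norm_num), Real.sq_sqrt (by positivity)]
      have e : r ^ 2 * κ n * (1 + r ^ 2 * κ n) * b n ^ 2 = r ^ 2 * κ n / (1 + r ^ 2 * κ n) := by
        have := (hq n).ne'
        simp only [hb]; field_simp
      rw [e]
      have hth' : ‖UnitAddTorus.mFourier n t₁ - UnitAddTorus.mFourier n t₂‖ ^ 2 ≤ 4 * (r ^ 2 * κ n) := by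
        rw [← mul_assoc]; exact hth
      set x := r ^ 2 * κ n
      rw [← mul_div_assoc, le_div_iff₀ (by positivity)]
      set y := ‖UnitAddTorus.mFourier n t₁ - UnitAddTorus.mFourier n t₂‖ ^ 2
      nlinarith
    calc _ ≤ c n * (√8 * (√(r ^ 2 * κ n * (1 + r ^ 2 * κ n)) * b n)) :=
          mul_le_mul_of_nonneg_left hθ (hc0 n)
      _ = _ := by simp only [ha]; ring
  have hfin : ‖F t₁ - F t₂‖ ≤ √8 * ∑' n, a n * b n := by
    rw [← H.tsum_eq, ← tsum_mul_left]
    exact tsum_of_norm_bounded (sab.mul_left (√8)).hasSum key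
  have hab0 : 0 ≤ ∑' n, a n * b n := tsum_nonneg fun n => mul_nonneg (ha0 n) (hb0 n)
  calc ‖F t₁ - F t₂‖ ^ 2 ≤ (√8 * ∑' n, a n * b n) ^ 2 := by gcongr
    _ = 8 * (∑' n, a n * b n) ^ 2 := by rw [mul_pow, Real.sq_sqrt (by norm_num)]
    _ ≤ 8 * (2 * r ^ 4 * (E * (1 + Vs) * P) * (32 * (∏ i, l i) / r ^ d)) := by gcongr
    _ = 512 * (r ^ 4 / r ^ d) * (1 + Vs) * E * ((∏ i, l i) * P) := by ring
    _ = _ := by rw [hP, mul_one]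

abbrev EE (d : ℕ) := EuclideanSpace ℝ (Fin d)

/-- scaling map -/
def scl {d : ℕ} (l : Fin d → ℝ) (x : Fin d → ℝ) : EuclideanSpace ℝ (Fin d) :=
  WithLp.toLp 2 (fun i => l i * x i)

lemma lat_int {α : Type*} {d : ℕ} {L : ℝ} {γ : Fin d → ℝ} {f : EuclideanSpace ℝ (Fin d) → α}
    (hf : LatPeriodic d L γ f) (v : Fin d → ℤ) (x : EuclideanSpace ℝ (Fin d)) :
    f (x + ∑ i, (v i : ℝ) • latVec d L γ i) = f x := by
  have h1 : ∀ i, Function.Periodic f ((v i : ℝ) • latVec d L γ i) := by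
    intro i
    have : Function.Periodic f (latVec d L γ i) := fun x => hf x i
    have := this.zsmul (v i)
    rwa [← Int.cast_smul_eq_zsmul ℝ] at this
  have : ∀ s : Finset (Fin d), ∀ x, f (x + ∑ i ∈ s, (v i : ℝ) • latVec d L γ i) = f x := by
    intro s
    induction s using Finset.induction_on with
    | empty => intro x; simp
    | insert a s ha ih =>
      intro x
      rw [Finset.sum_insert ha, ← add_assoc, ih, h1 a]
  exact this _ x

def tlift {α : Type*} {d : ℕ} (l : Fin d → ℝ) (f : EuclideanSpace ℝ (Fin d) → α)
    (t : UnitAddTorus (Fin d)) : α :=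
  f (scl l (fun i => (AddCircle.equivIco (1:ℝ) 0 (t i) : ℝ)))

def tmk {d : ℕ} (x : Fin d → ℝ) : UnitAddTorus (Fin d) := fun i => (x i : UnitAddCircle)

lemma tmk_surj {d : ℕ} (t : UnitAddTorus (Fin d)) : ∃ x, tmk x = t :=
  ⟨fun i => (AddCircle.equivIco (1:ℝ) 0 (t i) : ℝ), funext fun i => AddCircle.coe_equivIco⟩

lemma tlift_mk {α : Type*} {d : ℕ} {L : ℝ} {γ : Fin d → ℝ} {f : EuclideanSpace ℝ (Fin d) → α}
    (hf : LatPeriodic d L γ f) (x : Fin d → ℝ) :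
    tlift (fun i => L * γ i) f (tmk x) = f (scl (fun i => L * γ i) x) := by
  have h : ∀ i, ∃ m : ℤ, (AddCircle.equivIco (1:ℝ) 0 (x i : UnitAddCircle) : ℝ) = x i + m := by
    intro i
    have h1 : (((AddCircle.equivIco (1:ℝ) 0 (x i : UnitAddCircle) : ℝ) : ℝ) : UnitAddCircle) = (x i : UnitAddCircle) :=
      AddCircle.coe_equivIco
    have h2 : (((AddCircle.equivIco (1:ℝ) 0 (x i : UnitAddCircle) : ℝ) - x i : ℝ) : UnitAddCircle) = 0 := by
      rw [AddCircle.coe_sub, h1, sub_self]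
    obtain ⟨m, hm⟩ := (AddCircle.coe_eq_zero_iff 1).1 h2
    refine ⟨m, ?_⟩
    rw [zsmul_eq_mul, mul_one] at hm
    linarith
  choose v hv using h
  unfold tlift
  rw [← lat_int hf v (scl _ x)]
  congr 1
  ext i
  simp only [scl, tmk, hv, latVec]
  simp [Finset.sum_apply, Pi.single_apply]
  ring

lemma tlift_cont {α : Type*} [TopologicalSpace α] {d : ℕ} {L : ℝ} {γ : Fin d → ℝ}
    {f : EuclideanSpace ℝ (Fin d) → α}
    (hf : LatPeriodic d L γ f) (hc : Continuous f) : Continuous (tlift (fun i => L * γ i) f) := by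
  have hq : IsOpenQuotientMap (Pi.map (fun (_ : Fin d) (x : ℝ) => (x : UnitAddCircle))) :=
    IsOpenQuotientMap.piMap fun _ => QuotientAddGroup.isOpenQuotientMap_mk
  rw [← hq.continuous_comp_iff]
  have : (tlift (fun i => L * γ i) f) ∘ (Pi.map (fun (_ : Fin d) (x : ℝ) => (x : UnitAddCircle))) =
      f ∘ (scl (fun i => L * γ i)) := by
    funext x
    exact tlift_mk hf x
  rw [this]
  refine hc.comp ?_
  unfold scl
  fun_prop

lemma tlift_pd {d : ℕ} {L : ℝ} {γ : Fin d → ℝ} {f : EuclideanSpace ℝ (Fin d) → ℂ}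
    (hf : LatPeriodic d L γ f) (hd : Differentiable ℝ f) (i : Fin d)
    (hf' : LatPeriodic d L γ (fun y => fderiv ℝ f y (EuclideanSpace.single i 1))) :
    HasPD i (tlift (fun i => L * γ i) f) (fun t => ((L * γ i : ℝ) : ℂ) *
      tlift (fun i => L * γ i) (fun y => fderiv ℝ f y (EuclideanSpace.single i 1)) t) := by
  intro t
  obtain ⟨x, rfl⟩ := tmk_surj t
  beta_reduce
  rw [tlift_mk hf']
  have e : (fun s : ℝ => tlift (fun i => L * γ i) f (tmk x + Pi.single i (s : UnitAddCircle))) =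
      fun s : ℝ => f (scl (fun i => L * γ i) x + s • ((L * γ i) • EuclideanSpace.single i (1:ℝ))) := by
    funext s
    have : tmk x + Pi.single i (s : UnitAddCircle) = tmk (x + Pi.single i s) := by
      funext j
      by_cases hj : j = i
      · subst hj; simp [tmk]
      · simp [tmk, hj]
    rw [this, tlift_mk hf]
    congr 1
    ext j
    by_cases hj : j = i
    · subst hj; simp [scl]; ring
    · simp [scl, hj]
  rw [e]
  set v : EuclideanSpace ℝ (Fin d) := (L * γ i) • EuclideanSpace.single i (1:ℝ) with hv
  have hdv : HasDerivAt (fun s : ℝ => scl (fun i => L * γ i) x + s • v) v 0 := by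
    have := ((hasDerivAt_id (0:ℝ)).smul_const v).const_add (scl (fun i => L * γ i) x)
    simpa using this
  have hF : HasFDerivAt f (fderiv ℝ f (scl (fun i => L * γ i) x))
      (scl (fun i => L * γ i) x + (0:ℝ) • v) := by
    rw [zero_smul, add_zero]
    exact (hd _).hasFDerivAt
  refine (hF.comp_hasDerivAt (0:ℝ) hdv).congr_deriv ?_
  rw [hv, map_smul]
  simp

lemma lat_fderiv {d : ℕ} {L : ℝ} {γ : Fin d → ℝ} {f : EuclideanSpace ℝ (Fin d) → ℂ}
    (hf : LatPeriodic d L γ f) (w : EuclideanSpace ℝ (Fin d)) :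
    LatPeriodic d L γ (fun y => fderiv ℝ f y w) := by
  intro x i
  simp only
  rw [← fderiv_comp_add_right]
  congr 2
  funext y
  exact hf y i

lemma tlift_integral {d : ℕ} {L : ℝ} {γ : Fin d → ℝ} {f : EuclideanSpace ℝ (Fin d) → ℝ}
    (hf : LatPeriodic d L γ f) (hl : ∀ i, 0 < L * γ i) :
    ∫ x in fund d L γ, f x = (∏ i, (L * γ i)) * ∫ t, tlift (fun i => L * γ i) f t ∂(muT d) := by
  set l : Fin d → ℝ := fun i => L * γ i with hldef
  have hprod : 0 < ∏ i, l i := Finset.prod_pos fun i _ => hl i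
  rw [muT_preimage]
  have h0 : ∀ x : Fin d → ℝ, tlift l f (fun i => (x i : UnitAddCircle)) = f (scl l x) :=
    fun x => tlift_mk hf x
  simp only [h0]
  have hdet : (Matrix.diagonal l).det ≠ 0 := by rw [Matrix.det_diagonal]; exact hprod.ne'
  have hv := Real.smul_map_diagonal_volume_pi hdet
  rw [Matrix.det_diagonal, abs_of_pos hprod] at hv
  have hpre := (PiLp.volume_preserving_toLp (Fin d)).setIntegral_preimage_emb
    (MeasurableEquiv.toLp 2 (Fin d → ℝ)).measurableEmbedding f (fund d L γ)
  have hD : ∀ x, Matrix.toLin' (Matrix.diagonal l) x = fun i => l i * x i := by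
    intro x; funext i; simp [Matrix.mulVec_diagonal]
  have hemb : MeasurableEmbedding (Matrix.toLin' (Matrix.diagonal l)) := by
    apply Continuous.measurableEmbedding
    · exact LinearMap.continuous_of_finiteDimensional _
    · intro x y hxy
      rw [hD, hD] at hxy
      funext i
      exact mul_left_cancel₀ (hl i).ne' (congrFun hxy i)
  rw [← hpre]
  have this : ∫ x in WithLp.toLp 2 ⁻¹' fund d L γ, f (WithLp.toLp 2 x) = (∏ i, l i) *
      ∫ x in (Matrix.toLin' (Matrix.diagonal l)) ⁻¹' (WithLp.toLp 2 ⁻¹' fund d L γ),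
        f (WithLp.toLp 2 (Matrix.toLin' (Matrix.diagonal l) x)) := by
    conv_lhs => rw [← hv]
    rw [Measure.restrict_smul, integral_smul_measure, ENNReal.toReal_ofReal hprod.le,
      smul_eq_mul, hemb.setIntegral_map]
  refine this.trans ?_
  congr 1
  simp only [hD]
  change ∫ x in _, f (scl l x) = _
  apply setIntegral_congr_set
  have e1 : (Matrix.toLin' (Matrix.diagonal l)) ⁻¹' (WithLp.toLp 2 ⁻¹' fund d L γ) =
      Set.univ.pi (fun _ : Fin d => Set.Ico (0:ℝ) 1) := by
    ext x
    simp only [Set.mem_preimage, hD, fund, Set.mem_setOf_eq, Set.mem_univ_pi, Set.mem_Ico]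
    refine forall_congr' fun i => ?_
    have := hl i
    change 0 ≤ l i * x i ∧ l i * x i < l i ↔ _
    constructor
    · rintro ⟨a, b⟩
      exact ⟨nonneg_of_mul_nonneg_right a this, by nlinarith⟩
    · rintro ⟨a, b⟩
      exact ⟨by positivity, by nlinarith⟩
  have e2 : {x : Fin d → ℝ | ∀ i, x i ∈ Set.Ioc (0:ℝ) 1} =
      Set.univ.pi (fun _ : Fin d => Set.Ioc (0:ℝ) 1) := by ext; simp
  rw [e1, e2]
  exact Measure.univ_pi_Ico_ae_eq_Icc.trans Measure.univ_pi_Ioc_ae_eq_Icc.symm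

lemma mFourier_mk {d : ℕ} (n : Fin d → ℤ) (x : Fin d → ℝ) :
    UnitAddTorus.mFourier n (tmk x) = Complex.exp (Complex.I * (∑ i, 2 * π * n i * x i : ℝ)) := by
  simp only [UnitAddTorus.mFourier, tmk, ContinuousMap.coe_mk, fourier_coe_apply]
  rw [← Complex.exp_sum]
  congr 1
  push_cast
  rw [Finset.mul_sum]
  refine Finset.sum_congr rfl fun i _ => ?_
  simp; ring

lemma mFourier_diff {d : ℕ} (l : Fin d → ℝ) (hl : ∀ i, 0 < l i) (n : Fin d → ℤ) (y₁ y₂ : Fin d → ℝ)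
    (r : ℝ) (hr : 0 ≤ r) (h : ‖scl l y₁ - scl l y₂‖ ≤ 2 * r) :
    ‖UnitAddTorus.mFourier n (tmk y₁) - UnitAddTorus.mFourier n (tmk y₂)‖ ^ 2 ≤
      4 * r ^ 2 * ∑ i, (2 * π * n i / l i) ^ 2 := by
  rw [mFourier_mk, mFourier_mk]
  set A := ∑ i, 2 * π * n i * y₁ i
  set B := ∑ i, 2 * π * n i * y₂ i
  have e : Complex.exp (Complex.I * (A : ℝ)) - Complex.exp (Complex.I * (B : ℝ)) =
      Complex.exp (Complex.I * (B : ℝ)) * (Complex.exp (Complex.I * ((A - B : ℝ) : ℂ)) - 1) := by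
    rw [mul_sub, ← Complex.exp_add]; push_cast; ring_nf
  have hB : ‖Complex.exp (Complex.I * (B : ℝ))‖ = 1 := by
    rw [mul_comm]; exact Complex.norm_exp_ofReal_mul_I B
  rw [e, norm_mul, hB, one_mul]
  have h1 := Real.norm_exp_I_mul_ofReal_sub_one_le (x := A - B)
  have hAB : A - B = ∑ i, (2 * π * n i / l i) * ((scl l y₁ - scl l y₂) i) := by
    simp only [A, B, ← Finset.sum_sub_distrib]
    refine Finset.sum_congr rfl fun i _ => ?_
    have := (hl i).ne'
    simp [scl]
    field_simp
  calc _ ≤ ‖A - B‖ ^ 2 := by gcongr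
    _ = (A - B) ^ 2 := by simp
    _ ≤ (∑ i, (2 * π * n i / l i) ^ 2) * ∑ i, ((scl l y₁ - scl l y₂) i) ^ 2 := by
      rw [hAB]; exact Finset.sum_mul_sq_le_sq_mul_sq _ _ _
    _ = (∑ i, (2 * π * n i / l i) ^ 2) * ‖scl l y₁ - scl l y₂‖ ^ 2 := by
      rw [EuclideanSpace.real_norm_sq_eq]
    _ ≤ (∑ i, (2 * π * n i / l i) ^ 2) * (2 * r) ^ 2 := by gcongr
    _ = _ := by ring

lemma scl_surj {d : ℕ} (l : Fin d → ℝ) (hl : ∀ i, 0 < l i) (x : EuclideanSpace ℝ (Fin d)) :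
    ∃ y, scl l y = x :=
  ⟨fun i => x i / l i, by ext i; have := (hl i).ne'; simp [scl]; field_simp⟩

lemma ball_rep {d : ℕ} {L : ℝ} {γ : Fin d → ℝ} {f : EuclideanSpace ℝ (Fin d) → ℂ}
    (hf : LatPeriodic d L γ f) {x x₀ : EuclideanSpace ℝ (Fin d)} {r : ℝ}
    (hx : x ∈ torusBall d L γ x₀ r) : ∃ y, f y = f x ∧ ‖y - x₀‖ < r := by
  obtain ⟨v, hv⟩ := exists_lt_of_ciInf_lt (show torusDist d L γ x x₀ < r from hx)
  refine ⟨x - ∑ i, (v i : ℝ) • latVec d L γ i, ?_, ?_⟩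
  · have := lat_int hf v (x - ∑ i, (v i : ℝ) • latVec d L γ i)
    rw [sub_add_cancel] at this
    exact this.symm
  · rw [sub_right_comm]; exact hv

lemma coeff_smul {d : ℕ} (c : ℂ) (F : UnitAddTorus (Fin d) → ℂ) (n : Fin d → ℤ) :
    UnitAddTorus.mFourierCoeff (fun t => c * F t) n = c * UnitAddTorus.mFourierCoeff F n := by
  rw [muT_def, muT_def, ← integral_const_mul]
  congr 1; funext t; ring

lemma coeff_lap {d : ℕ} {L : ℝ} {γ : Fin d → ℝ} {f : EuclideanSpace ℝ (Fin d) → ℂ}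
    (hl : ∀ i, 0 < L * γ i)
    (hf : LatPeriodic d L γ f) (hc : ContDiff ℝ 2 f) (n : Fin d → ℤ) :
    UnitAddTorus.mFourierCoeff (tlift (fun i => L * γ i) (lap d f)) n =
      -((∑ i, (2 * π * n i / (L * γ i)) ^ 2 : ℝ) : ℂ) *
        UnitAddTorus.mFourierCoeff (tlift (fun i => L * γ i) f) n := by
  have hc1 : ∀ i, ContDiff ℝ 1 (fun y => fderiv ℝ f y (EuclideanSpace.single i 1)) := fun i =>
    (hc.fderiv_right (m := 1) (by norm_num)).clm_apply contDiff_const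
  have hc0 : ∀ i, Continuous (fun x => fderiv ℝ (fun y => fderiv ℝ f y (EuclideanSpace.single i 1)) x
      (EuclideanSpace.single i 1)) := fun i =>
    (((hc1 i).fderiv_right (m := 0) (by norm_num)).clm_apply contDiff_const).continuous
  have p1 := fun i => lat_fderiv hf (EuclideanSpace.single i 1)
  have p2 := fun i => lat_fderiv (p1 i) (EuclideanSpace.single i 1)
  set l : Fin d → ℝ := fun i => L * γ i with hldef
  have k1 : ∀ i, UnitAddTorus.mFourierCoeff (tlift l (fun x => fderiv ℝ
      (fun y => fderiv ℝ f y (EuclideanSpace.single i 1)) x (EuclideanSpace.single i 1))) n =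
      -(((2 * π * n i / l i) ^ 2 : ℝ) : ℂ) * UnitAddTorus.mFourierCoeff (tlift l f) n := by
    intro i
    have c0 := tlift_cont hf hc.continuous
    have c1 := tlift_cont (p1 i) (hc1 i).continuous
    have c2 := tlift_cont (p2 i) (hc0 i)
    have a1 := coeff_pd (tlift_pd hf (hc.differentiable (by norm_num)) i (p1 i)) c0
      (continuous_const.mul c1) n
    have a2 := coeff_pd (tlift_pd (p1 i) ((hc1 i).differentiable (by norm_num)) i (p2 i)) c1
      (continuous_const.mul c2) n
    rw [coeff_smul] at a1 a2
    have hli : ((l i : ℝ) : ℂ) ≠ 0 := by exact_mod_cast (hl i).ne'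
    have b1 := eq_div_of_mul_eq hli ((mul_comm _ _).trans a1)
    have b2 := eq_div_of_mul_eq hli ((mul_comm _ _).trans a2)
    rw [b2, b1]
    push_cast
    field_simp
    linear_combination ((n i : ℂ) ^ 2 * UnitAddTorus.mFourierCoeff (tlift l f) n) * Complex.I_sq
  have e : tlift l (lap d f) = fun t => ∑ i, tlift l (fun x => fderiv ℝ
      (fun y => fderiv ℝ f y (EuclideanSpace.single i 1)) x (EuclideanSpace.single i 1)) t := rfl
  rw [e, muT_def]
  simp only [Finset.mul_sum]
  rw [integral_finsetSum]
  · simp only [← muT_def, k1]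
    push_cast
    rw [← Finset.sum_mul, Finset.sum_neg_distrib]
    simp [hldef]
  · intro i _
    have c2 := tlift_cont (p2 i) (hc0 i)
    exact muT_integrable _ _ ((UnitAddTorus.mFourier (-n)).continuous.mul c2)

/-- **Variation bound** (Section 3.1): there is an absolute constant `c > 0` such that any
`L²`-normalized solution of `(-Δ+V)Ψ = EΨ` on `𝕋^d_L` (`d ≤ 3`, `0 < E < 1`) which is
localized near `x₀` in the sense `∫_{𝕋^d_L ∖ B(x₀,r)} |Ψ|² dμ ≤ E` for some `1 ≤ r ≤ L/2`
satisfies `|Ψ(x₁) - Ψ(x₂)| ≤ c r^{(4-d)/2} (1 + ‖V‖_∞^{1/2}) E^{1/2}` for all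
`x₁, x₂ ∈ B(x₀, r)`. -/
theorem variation_bound :
    ∃ c : ℝ, 0 < c ∧
      ∀ (d : ℕ) (hd : 0 < d), d ≤ 3 →
      ∀ L : ℝ, 0 < L →
      ∀ γ : Fin d → ℝ, (∀ i, 1 ≤ γ i) → γ ⟨0, hd⟩ = 1 →
      ∀ (V : EuclideanSpace ℝ (Fin d) → ℝ) (Vsup : ℝ),
        Measurable V → (∀ x, 0 ≤ V x) → (∀ x, V x ≤ Vsup) → LatPeriodic d L γ V →
      ∀ E : ℝ, 0 < E → E < 1 →
      ∀ Ψ : EuclideanSpace ℝ (Fin d) → ℂ, IsSolution d L γ V E Ψ →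
      ∀ (x₀ : EuclideanSpace ℝ (Fin d)) (r : ℝ), 1 ≤ r → r ≤ L / 2 →
        (∫ x in fund d L γ \ torusBall d L γ x₀ r, ‖Ψ x‖ ^ 2) ≤ E →
      ∀ x₁ ∈ torusBall d L γ x₀ r, ∀ x₂ ∈ torusBall d L γ x₀ r,
        ‖Ψ x₁ - Ψ x₂‖ ≤
          c * r ^ (((4:ℝ) - d) / 2) * (1 + Vsup ^ ((1:ℝ)/2)) * E ^ ((1:ℝ)/2) := by

  refine ⟨23, by norm_num, ?_⟩
  intro d hd0 hd L hL γ hγ _ V Vsup _ hV0 hV1 hVp E hE hE1 Ψ hΨ x₀ r hr hrL _ x₁ hx₁ x₂ hx₂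
  obtain ⟨hC, hper, heq, hnorm⟩ := hΨ
  have hl : ∀ i, 0 < L * γ i := fun i => by have := hγ i; positivity
  have hl2 : ∀ i, 2 * r ≤ L * γ i := fun i => by nlinarith [hγ i]
  obtain ⟨z₁, hz₁, hn₁⟩ := ball_rep hper hx₁
  obtain ⟨z₂, hz₂, hn₂⟩ := ball_rep hper hx₂
  obtain ⟨y₁, rfl⟩ := scl_surj (fun i => L * γ i) hl z₁
  obtain ⟨y₂, rfl⟩ := scl_surj (fun i => L * γ i) hl z₂
  have hlap : lap d Ψ = fun x => ((V x - E : ℝ) : ℂ) * Ψ x := by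
    funext x
    have := heq x
    push_cast
    linear_combination -this
  have hlapp : LatPeriodic d L γ (lap d Ψ) := by
    intro x i
    rw [hlap]
    simp only
    rw [hVp x i, hper x i]
  have hlapc : Continuous (lap d Ψ) := by
    unfold lap
    refine continuous_finset_sum _ fun i _ => ?_
    have hc1 : ContDiff ℝ 1 (fun y => fderiv ℝ Ψ y (EuclideanSpace.single i 1)) :=
      (hC.fderiv_right (m := 1) (by norm_num)).clm_apply contDiff_const
    exact ((hc1.fderiv_right (m := 0) (by norm_num)).clm_apply contDiff_const).continuous
  have hdist : ‖scl (fun i => L * γ i) y₁ - scl (fun i => L * γ i) y₂‖ ≤ 2 * r := by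
    have := norm_sub_le (scl (fun i => L * γ i) y₁ - x₀) (scl (fun i => L * γ i) y₂ - x₀)
    rw [sub_sub_sub_cancel_right] at this
    linarith
  have hnp : LatPeriodic d L γ (fun x => ‖Ψ x‖ ^ 2) := fun x i => by simp only [hper x i]
  have hmain := torus_main hd (fun i => L * γ i) r hr hl2
    ⟨tlift (fun i => L * γ i) Ψ, tlift_cont hper hC.continuous⟩
    ⟨tlift (fun i => L * γ i) (lap d Ψ), tlift_cont hlapp hlapc⟩
    (fun n => coeff_lap hl hper hC n)
    (tlift (fun i => L * γ i) V) Vsup E hE hE1 (fun t => hV0 _) (fun t => hV1 _)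
    (fun t => by
      simp only [ContinuousMap.coe_mk, tlift]
      rw [hlap])
    (by
      have := tlift_integral hnp hl
      rw [hnorm] at this
      exact this.symm)
    (tmk y₁) (tmk y₂) (fun n => mFourier_diff _ hl n y₁ y₂ r (by linarith) hdist)
  simp only [ContinuousMap.coe_mk] at hmain
  rw [tlift_mk hper, tlift_mk hper, hz₁, hz₂] at hmain
  have hVs : 0 ≤ Vsup := (hV0 0).trans (hV1 0)
  have hr0 : 0 < r := by linarith
  rw [← Real.sqrt_eq_rpow, ← Real.sqrt_eq_rpow]
  have hpow : (r ^ (((4:ℝ) - d) / 2)) ^ 2 = r ^ 4 / r ^ d := by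
    rw [← Real.rpow_natCast, ← Real.rpow_mul hr0.le]
    rw [show ((4:ℝ) - d) / 2 * ((2:ℕ) : ℝ) = ((4:ℕ):ℝ) - (d:ℝ) by push_cast; ring, Real.rpow_sub hr0,
      Real.rpow_natCast, Real.rpow_natCast]
  refine le_of_pow_le_pow_left₀ two_ne_zero (by positivity) (hmain.trans ?_)
  rw [mul_pow, mul_pow, mul_pow, hpow, Real.sq_sqrt hE.le]
  have h1 : 1 + Vsup ≤ (1 + √Vsup) ^ 2 := by
    nlinarith [Real.sq_sqrt hVs, Real.sqrt_nonneg Vsup]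
  gcongr
  norm_num
end
end

section
/- Let d ≤ 3, r' > 0, x₁, x₂ ∈ ℝ^d, and let b be the L² function on the torus ℝ^d/r'ℤ^d defined by the Fourier series b(x) = (1/(4π²)) Σ_{ξ ∈ ℤ^d ∖ {0}} (e(−ξ·x₁/r') − e(−ξ·x₂/r')) / (r'^d |ξ/r'|²) · e(ξ·x/r'). Then for every C² function f : ℝ^d → ℂ that is r'ℤ^d-periodic, f(x₁) − f(x₂) = ∫_{[0,r')^d} b · (−Δf) dμ, where Δ is the Euclidean Laplacian and μ Lebesgue measure. (That is, −Δb = δ_{x₁} − δ_{x₂} in the distributional sense on the torus.) -/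
open MeasureTheory Real Filter

noncomputable section

local instance instMST : MeasureSpace UnitAddCircle := ⟨AddCircle.haarAddCircle⟩

local instance instHT : Measure.IsAddHaarMeasure (volume : Measure UnitAddCircle) :=
  inferInstanceAs (Measure.IsAddHaarMeasure AddCircle.haarAddCircle)

local instance instPT : IsProbabilityMeasure (volume : Measure UnitAddCircle) :=
  inferInstanceAs (IsProbabilityMeasure AddCircle.haarAddCircle)

/-- section of the torus -/
def tsec (d : ℕ) (r' : ℝ) (t : UnitAddTorus (Fin d)) : EuclideanSpace ℝ (Fin d) :=
  r' • WithLp.toLp 2 (fun i => ((AddCircle.equivIoc 1 0 (t i)).1 : ℝ))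

theorem sec1_mp : MeasurePreserving (fun t : UnitAddCircle => ((AddCircle.equivIoc 1 0 t).1 : ℝ))
    volume (volume.restrict (Set.Ico (0:ℝ) 1)) := by
  have h := (AddCircle.measurePreserving_equivIoc (T := 1) (a := 0))
  have h2 : MeasurePreserving (Subtype.val : Set.Ioc (0:ℝ) (0+1) → ℝ)
      (Measure.comap Subtype.val volume) (volume.restrict (Set.Ioc (0:ℝ) (0+1))) :=
    ⟨measurable_subtype_coe, map_comap_subtype_coe measurableSet_Ioc _⟩
  have h3 := h2.comp h
  have e1 : (volume.restrict (Set.Ico (0:ℝ) 1)) = (volume.restrict (Set.Ioc (0:ℝ) (0+1))) := by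
    rw [zero_add]; exact Measure.restrict_congr_set Ico_ae_eq_Ioc
  have e2 : (volume : Measure UnitAddCircle) = @volume _ (AddCircle.measureSpace 1) := by
    simp only [volume, AddCircle.haarAddCircle, ENNReal.ofReal_one, one_smul]
  rw [e1, e2]
  exact h3

theorem fund_meas (d : ℕ) (r' : ℝ) : MeasurableSet (fund d r' (fun _ => 1)) := by
  have : fund d r' (fun _ => 1) = ⋂ i, {x | x i ∈ Set.Ico (0 : ℝ) (r' * 1)} := by
    ext x; simp [fund]
  rw [this]
  refine MeasurableSet.iInter fun i => ?_
  have : Measurable (fun x : EuclideanSpace ℝ (Fin d) => x i) := by fun_prop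
  exact this measurableSet_Ico

theorem tsec_mp (d : ℕ) (r' : ℝ) (hr' : 0 < r') :
    MeasurePreserving (tsec d r') volume
      (ENNReal.ofReal ((r' ^ d)⁻¹) • volume.restrict (fund d r' (fun _ => 1))) := by
  have h1 := measurePreserving_pi (fun _ : Fin d => (volume : Measure UnitAddCircle)) _
    (fun _ => sec1_mp)
  rw [← Measure.restrict_pi_pi] at h1
  have h2 := (PiLp.volume_preserving_toLp (Fin d)).restrict_preimage (fund_meas d 1)
  have e : (WithLp.toLp 2 ⁻¹' fund d 1 (fun _ => 1)) =
      (Set.univ.pi fun _ : Fin d => Set.Ico (0:ℝ) 1) := by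
    ext x; simp [fund]
  rw [e] at h2
  have h3 := h2.comp h1
  have h4 : MeasurePreserving (fun x : EuclideanSpace ℝ (Fin d) => r' • x)
      (volume.restrict (fund d 1 (fun _ => 1)))
      (ENNReal.ofReal ((r' ^ d)⁻¹) • volume.restrict (fund d r' (fun _ => 1))) := by
    refine ⟨by fun_prop, ?_⟩
    have := Measure.map_addHaar_smul (volume : Measure (EuclideanSpace ℝ (Fin d))) hr'.ne'
    rw [finrank_euclideanSpace_fin, abs_of_pos (by positivity)] at this
    rw [← Measure.restrict_smul, ← this, Measure.restrict_map (by fun_prop) (fund_meas d r')]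
    congr 2
    ext x
    simp only [fund, Set.mem_ofPred_eq, Set.mem_preimage, PiLp.smul_apply, smul_eq_mul, mul_one,
      Set.mem_Ico]
    refine forall_congr' fun i => and_congr ?_ ?_
    · rw [mul_nonneg_iff_of_pos_left hr']
    · constructor <;> intro h <;> nlinarith
  exact h4.comp h3

theorem per_int {d : ℕ} {r' : ℝ} {α : Type*} {g : EuclideanSpace ℝ (Fin d) → α}
    (hg : LatPeriodic d r' (fun _ => 1) g) (n : Fin d → ℤ) (x : EuclideanSpace ℝ (Fin d)) :
    g (x + WithLp.toLp 2 (fun i => (n i : ℝ) * r')) = g x := by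
  have key : ∀ (s : Finset (Fin d)) x, g (x + ∑ i ∈ s, n i • latVec d r' (fun _ => 1) i) = g x := by
    intro s
    induction s using Finset.induction_on with
    | empty => simp
    | insert i s hi ih =>
      intro x
      rw [Finset.sum_insert hi, ← add_assoc, ih]
      have hp : Function.Periodic g (latVec d r' (fun _ => 1) i) := fun x => hg x i
      exact hp.zsmul (n i) x
  convert key Finset.univ x using 3
  ext j
  simp [latVec, Finset.sum_apply, Pi.single_apply]

theorem per_sec {d : ℕ} {r' : ℝ} {α : Type*} {g : EuclideanSpace ℝ (Fin d) → α}
    (hg : LatPeriodic d r' (fun _ => 1) g) (x : Fin d → ℝ) :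
    g (tsec d r' (fun i => (x i : UnitAddCircle))) = g (r' • WithLp.toLp 2 x) := by
  rw [← per_int hg (fun i => - toIocDiv one_pos 0 (x i)) (r' • WithLp.toLp 2 x)]
  congr 1
  ext i
  have : ((AddCircle.equivIoc 1 0 (x i : UnitAddCircle)).1 : ℝ) = toIocMod one_pos 0 (x i) := rfl
  simp only [tsec, PiLp.smul_apply, PiLp.add_apply, this, toIocMod, smul_eq_mul]
  simp
  ring

theorem cont_sec {d : ℕ} {r' : ℝ} {g : EuclideanSpace ℝ (Fin d) → ℂ}
    (hg : LatPeriodic d r' (fun _ => 1) g) (hc : Continuous g) :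
    Continuous (fun t => g (tsec d r' t)) := by
  have hq : IsOpenQuotientMap (Pi.map (fun (_ : Fin d) (x : ℝ) => (x : UnitAddCircle))) :=
    IsOpenQuotientMap.piMap (fun _ => QuotientAddGroup.isOpenQuotientMap_mk)
  rw [hq.isQuotientMap.continuous_iff]
  have : (fun t => g (tsec d r' t)) ∘ (Pi.map (fun (_ : Fin d) (x : ℝ) => (x : UnitAddCircle)))
      = fun x => g (r' • WithLp.toLp 2 x) := by
    funext x
    exact per_sec hg x
  rw [this]
  fun_prop

theorem ec_sec {d : ℕ} {r' : ℝ} (hr' : 0 < r') (ξ : Fin d → ℤ) (t : UnitAddTorus (Fin d)) :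
    UnitAddTorus.mFourier ξ t = ec d r' ξ (tsec d r' t) := by
  have hr : (r' : ℂ) ≠ 0 := by exact_mod_cast hr'.ne'
  have ht : ∀ i, t i = (((AddCircle.equivIoc 1 0 (t i)).1 : ℝ) : UnitAddCircle) := fun i =>
    ((AddCircle.equivIoc 1 0).symm_apply_apply (t i)).symm
  simp only [UnitAddTorus.mFourier, ContinuousMap.coe_mk, ec]
  rw [Finset.mul_sum, Finset.sum_div, Complex.exp_sum]
  refine Finset.prod_congr rfl fun i _ => ?_
  conv_lhs => rw [ht i]
  rw [fourier_coe_apply]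
  congr 1
  simp only [tsec, PiLp.smul_apply, smul_eq_mul]
  push_cast
  field_simp

theorem ec_periodic {d : ℕ} {r' : ℝ} (hr' : 0 < r') (ξ : Fin d → ℤ) :
    LatPeriodic d r' (fun _ => 1) (ec d r' ξ) := by
  intro x i
  have hr : (r' : ℂ) ≠ 0 := by exact_mod_cast hr'.ne'
  simp only [ec]
  rw [Complex.exp_eq_exp_iff_exists_int]
  refine ⟨ξ i, ?_⟩
  have : ∑ j, (ξ j : ℂ) * (((x + latVec d r' (fun _ => 1) i) j : ℝ) : ℂ) =
      ∑ j, (ξ j : ℂ) * (x j : ℂ) + ξ i * r' := by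
    have h : ∀ j, (ξ j : ℂ) * (((x + latVec d r' (fun _ => 1) i) j : ℝ) : ℂ) =
        (ξ j : ℂ) * (x j : ℂ) + if j = i then (ξ j : ℂ) * r' else 0 := by
      intro j
      by_cases hj : j = i <;> simp [latVec, mul_add, hj]
    rw [Finset.sum_congr rfl fun j _ => h j, Finset.sum_add_distrib]
    simp
  rw [this]
  field_simp

theorem ec_neg {d : ℕ} {r' : ℝ} (ξ : Fin d → ℤ) (x : EuclideanSpace ℝ (Fin d)) :
    (starRingEnd ℂ) (ec d r' ξ x) = ec d r' (-ξ) x := by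
  simp only [ec, ← Complex.exp_conj]
  congr 1
  simp [Complex.conj_ofNat]

theorem div_zero_int {d : ℕ} (hd : 0 < d) {r' : ℝ} (hr' : 0 < r')
    (V : Fin d → EuclideanSpace ℝ (Fin d) → ℂ) (hV : ∀ i, ContDiff ℝ 1 (V i))
    (hp : ∀ i, LatPeriodic d r' (fun _ => 1) (V i)) :
    ∫ x in fund d r' (fun _ => 1), ∑ i, fderiv ℝ (V i) x (EuclideanSpace.single i 1) = 0 := by
  obtain ⟨n, rfl⟩ : ∃ n, d = n + 1 := ⟨d - 1, by omega⟩
  set G : EuclideanSpace ℝ (Fin (n+1)) → ℂ :=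
    fun x => ∑ i, fderiv ℝ (V i) x (EuclideanSpace.single i 1) with hG
  have hGc : Continuous G := by
    refine continuous_finsetSum _ fun i _ => ?_
    exact ((hV i).continuous_fderiv (by norm_num)).clm_apply continuous_const
  rw [← (PiLp.volume_preserving_toLp (Fin (n+1))).setIntegral_preimage_emb
    (MeasurableEquiv.toLp 2 _).measurableEmbedding]
  have e : (WithLp.toLp 2 ⁻¹' fund (n+1) r' (fun _ => 1)) =
      (Set.univ.pi fun _ : Fin (n+1) => Set.Ico (0:ℝ) r') := by
    ext x; simp [fund]
  rw [e]
  have e2 : ((Set.univ.pi fun _ : Fin (n+1) => Set.Ico (0:ℝ) r') : Set (Fin (n+1) → ℝ))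
      =ᵐ[volume] Set.Icc (fun _ => (0:ℝ)) (fun _ => r') :=
    Measure.univ_pi_Ico_ae_eq_Icc
  rw [Measure.restrict_congr_set e2]
  let T : (Fin (n+1) → ℝ) →L[ℝ] EuclideanSpace ℝ (Fin (n+1)) :=
    ((PiLp.continuousLinearEquiv 2 ℝ (fun _ : Fin (n+1) => ℝ)).symm : _ →L[ℝ] _)
  have hT : ∀ x, T x = WithLp.toLp 2 x := fun x => rfl
  have key := integral_divergence_of_hasFDerivAt_off_countable' (fun _ : Fin (n+1) => (0:ℝ))
    (fun _ => r') (fun _ => hr'.le) (fun i x => V i (T x))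
    (fun i x => (fderiv ℝ (V i) (T x)).comp T) ∅ Set.countable_empty
    (fun i => ((hV i).continuous.comp T.continuous).continuousOn)
    (fun x _ i => by
      have h1 := ((hV i).differentiable (by norm_num) (T x)).hasFDerivAt
      exact h1.comp x T.hasFDerivAt)
    (by
      refine Continuous.integrableOn_Icc ?_
      exact hGc.comp T.continuous)
  have h0 : ∀ i : Fin (n+1), ∀ x : Fin n → ℝ, V i (T (i.insertNth r' x)) =
      V i (T (i.insertNth 0 x)) := by
    intro i x
    rw [← hp i (T (i.insertNth 0 x)) i]
    congr 1
    ext j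
    refine Fin.succAboveCases i ?_ (fun k => ?_) j
    · simp [hT, latVec]
    · simp [hT, latVec]
  simp only [h0, sub_self, Finset.sum_const_zero] at key
  rw [← key]
  rfl

theorem fderiv_per {d : ℕ} {r' : ℝ} {g : EuclideanSpace ℝ (Fin d) → ℂ}
    (hg : LatPeriodic d r' (fun _ => 1) g) (v : EuclideanSpace ℝ (Fin d)) :
    LatPeriodic d r' (fun _ => 1) (fun y => fderiv ℝ g y v) := by
  intro x i
  have : (fun y => g (y + latVec d r' (fun _ => 1) i)) = g := funext fun y => hg y i
  have h2 := fderiv_comp_add_right (𝕜 := ℝ) (f := g) (x := x) (latVec d r' (fun _ => 1) i)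
  rw [this] at h2
  simp only [h2]

theorem lap_per {d : ℕ} {r' : ℝ} {g : EuclideanSpace ℝ (Fin d) → ℂ}
    (hg : LatPeriodic d r' (fun _ => 1) g) : LatPeriodic d r' (fun _ => 1) (lap d g) := by
  intro x i
  simp only [lap]
  exact Finset.sum_congr rfl fun j _ => fderiv_per (fderiv_per hg _) _ x i

theorem c1_d {d : ℕ} {g : EuclideanSpace ℝ (Fin d) → ℂ} (hg : ContDiff ℝ 2 g)
    (v : EuclideanSpace ℝ (Fin d)) : ContDiff ℝ 1 (fun y => fderiv ℝ g y v) :=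
  (hg.fderiv_right (m := 1) (by norm_num)).clm_apply contDiff_const

theorem lap_cont {d : ℕ} {g : EuclideanSpace ℝ (Fin d) → ℂ} (hg : ContDiff ℝ 2 g) :
    Continuous (lap d g) := by
  refine continuous_finsetSum _ fun i _ => ?_
  exact ((c1_d hg _).continuous_fderiv (by norm_num)).clm_apply continuous_const

theorem ec_contDiff {d : ℕ} {r' : ℝ} (ξ : Fin d → ℤ) : ContDiff ℝ 2 (ec d r' ξ) := by
  unfold ec
  refine ContDiff.cexp ?_
  refine ContDiff.div_const (contDiff_const.mul ?_) _
  refine ContDiff.sum fun i _ => contDiff_const.mul ?_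
  exact Complex.ofRealCLM.contDiff.comp (contDiff_piLp_apply (p := 2))

theorem ec_fderiv {d : ℕ} {r' : ℝ} (ξ : Fin d → ℤ) (x : EuclideanSpace ℝ (Fin d)) (i : Fin d) :
    fderiv ℝ (ec d r' ξ) x (EuclideanSpace.single i 1) =
      (2 * Real.pi * Complex.I * ξ i / r') * ec d r' ξ x := by
  have h := ((ec_contDiff (r' := r') ξ).differentiable (by norm_num) x).hasFDerivAt
  have h1 : HasDerivAt (fun t : ℝ => x + t • (EuclideanSpace.single i (1:ℝ)))
      (EuclideanSpace.single i (1:ℝ)) 0 := by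
    simpa using ((hasDerivAt_id (0:ℝ)).smul_const (EuclideanSpace.single i (1:ℝ))).const_add x
  have h2 := h
  rw [show x = x + (0:ℝ) • (EuclideanSpace.single i (1:ℝ)) by simp] at h2
  have h3 := h2.comp_hasDerivAt (0:ℝ) h1
  have e : (ec d r' ξ ∘ fun t : ℝ => x + t • (EuclideanSpace.single i (1:ℝ))) =
      fun t : ℝ => Complex.exp ((2 * Real.pi * Complex.I * ξ i / r') * (t : ℂ)) * ec d r' ξ x := by
    funext t
    simp only [ec, Function.comp, ← Complex.exp_add]
    congr 1
    have hh : ∀ j, (ξ j : ℂ) * (((x + t • (EuclideanSpace.single i (1:ℝ))) j : ℝ) : ℂ) =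
        (ξ j : ℂ) * (x j : ℂ) + if j = i then (ξ j : ℂ) * t else 0 := by
      intro j
      by_cases hj : j = i <;> simp [mul_add, hj]
    rw [Finset.sum_congr rfl fun j _ => hh j, Finset.sum_add_distrib]
    simp
    ring
  rw [e] at h3
  have h4 : HasDerivAt (fun t : ℝ => Complex.exp ((2 * Real.pi * Complex.I * ξ i / r') * (t : ℂ))
      * ec d r' ξ x) ((2 * Real.pi * Complex.I * ξ i / r') * ec d r' ξ x) 0 := by
    have h5 : HasDerivAt (fun t : ℝ => (2 * Real.pi * Complex.I * ξ i / r') * (t : ℂ))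
      (2 * Real.pi * Complex.I * ξ i / r') 0 := by
      simpa using (Complex.ofRealCLM.hasDerivAt (x := (0:ℝ))).const_mul
        (2 * Real.pi * Complex.I * ξ i / r')
    simpa using h5.cexp.mul_const (ec d r' ξ x)
  have h6 := h3.unique h4
  simpa using h6

theorem fund_sub (d : ℕ) (r' : ℝ) : ∃ K : Set (EuclideanSpace ℝ (Fin d)), IsCompact K ∧
    fund d r' (fun _ => 1) ⊆ K := by
  refine ⟨WithLp.ofLp ⁻¹' (Set.Icc (fun _ => 0) (fun _ => r')), ?_, ?_⟩
  · exact ((PiLp.homeomorph 2 (fun _ : Fin d => ℝ)).isCompact_preimage).2 isCompact_Icc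
  · intro x hx
    refine ⟨fun i => (hx i).1, fun i => ?_⟩
    have := (hx i).2.le
    simpa using this

theorem cont_int {d : ℕ} {r' : ℝ} {g : EuclideanSpace ℝ (Fin d) → ℂ} (hg : Continuous g) :
    IntegrableOn g (fund d r' (fun _ => 1)) := by
  obtain ⟨K, hK, hs⟩ := fund_sub d r'
  exact (hg.continuousOn.integrableOn_compact hK).mono_set hs

theorem green_coeff {d : ℕ} (hd : 0 < d) {r' : ℝ} (hr' : 0 < r')
    {f : EuclideanSpace ℝ (Fin d) → ℂ} (hf : ContDiff ℝ 2 f)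
    (hfper : LatPeriodic d r' (fun _ => 1) f) (ξ : Fin d → ℤ) :
    ∫ x in fund d r' (fun _ => 1), (-lap d f x) * ec d r' ξ x =
      (4 * (Real.pi : ℂ) ^ 2 * (((∑ i, ((ξ i : ℝ)) ^ 2) / r' ^ 2 : ℝ) : ℂ)) *
      ∫ x in fund d r' (fun _ => 1), f x * ec d r' ξ x := by
  set a : Fin d → ℂ := fun i => 2 * Real.pi * Complex.I * ξ i / r' with ha
  have hec := ec_contDiff (d := d) (r' := r') ξ
  have hec1 : ContDiff ℝ 1 (ec d r' ξ) := hec.of_le (by norm_num)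
  have hf1 : ContDiff ℝ 1 f := hf.of_le (by norm_num)
  have h0 := div_zero_int hd hr'
    (fun i x => fderiv ℝ f x (EuclideanSpace.single i 1) * ec d r' ξ x - a i * (f x * ec d r' ξ x))
    (fun i => ((c1_d hf _).mul hec1).sub (contDiff_const.mul (hf1.mul hec1)))
    (fun i x j => by
      have h1 := fderiv_per hfper (EuclideanSpace.single i 1) x j
      have h2 := hfper x j
      have h3 := ec_periodic hr' ξ x j
      simp only at h1
      simp only [h1, h2, h3])
  have h1 : ∀ x, ∑ i, fderiv ℝ (fun x => fderiv ℝ f x (EuclideanSpace.single i 1) * ec d r' ξ x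
      - a i * (f x * ec d r' ξ x)) x (EuclideanSpace.single i 1)
      = lap d f x * ec d r' ξ x - (∑ i, a i ^ 2) * (f x * ec d r' ξ x) := by
    intro x
    simp only [lap, Finset.sum_mul, ← Finset.sum_sub_distrib]
    refine Finset.sum_congr rfl fun i _ => ?_
    have d1 : DifferentiableAt ℝ (fun x => fderiv ℝ f x (EuclideanSpace.single i 1)) x :=
      (c1_d hf _).differentiable (by norm_num) x
    have d2 : DifferentiableAt ℝ (ec d r' ξ) x := hec1.differentiable (by norm_num) x
    have d3 : DifferentiableAt ℝ f x := hf1.differentiable (by norm_num) x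
    have H := (d1.hasFDerivAt.mul d2.hasFDerivAt).sub
      ((d3.hasFDerivAt.mul d2.hasFDerivAt).const_mul (a i))
    have H' := congrArg (fun l => l (EuclideanSpace.single i 1)) H.fderiv
    refine Eq.trans H' ?_
    simp [ec_fderiv]
    simp only [ha]
    ring
  simp only [h1] at h0
  have i1 : IntegrableOn (fun x => lap d f x * ec d r' ξ x) (fund d r' (fun _ => 1)) :=
    cont_int ((lap_cont hf).mul hec.continuous)
  have i2 : IntegrableOn (fun x => (∑ i, a i ^ 2) * (f x * ec d r' ξ x))
      (fund d r' (fun _ => 1)) :=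
    cont_int (continuous_const.mul (hf.continuous.mul hec.continuous))
  rw [integral_sub i1 i2, integral_const_mul] at h0
  have h2 : (∑ i, a i ^ 2) = - (4 * (Real.pi : ℂ) ^ 2 *
      (((∑ i, ((ξ i : ℝ)) ^ 2) / r' ^ 2 : ℝ) : ℂ)) := by
    simp only [ha]
    push_cast
    rw [Finset.sum_div, Finset.mul_sum, ← Finset.sum_neg_distrib]
    refine Finset.sum_congr rfl fun i _ => ?_
    rw [div_pow, mul_pow, mul_pow, mul_pow, Complex.I_sq]
    ring
  rw [h2] at h0
  simp only [neg_mul, integral_neg] at h0 ⊢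
  linear_combination -h0

theorem summable_lat {d : ℕ} (hd3 : d ≤ 3) :
    Summable (fun ξ : Fin d → ℤ => ((∑ i, ((ξ i : ℝ)) ^ 2)⁻¹) ^ 2) := by
  let b := (EuclideanSpace.basisFun (Fin d) ℝ).toBasis
  let L : Submodule ℤ (EuclideanSpace ℝ (Fin d)) := Submodule.span ℤ (Set.range b)
  have hr : Module.finrank ℤ L < 4 := by
    have := finrank_range_le_card (R := ℤ) (b := b)
    rw [Set.finrank, Fintype.card_fin] at this
    exact lt_of_le_of_lt this (by omega)
  have hs := ZLattice.summable_norm_pow_inv L 4 hr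
  let φ : (Fin d → ℤ) → L := fun ξ => ⟨WithLp.toLp 2 (fun i => (ξ i : ℝ)), by
    have : WithLp.toLp 2 (fun i => (ξ i : ℝ)) = ∑ i, ξ i • b i := by
      ext j
      simp [b, Finset.sum_apply, Pi.single_apply]
    rw [this]
    exact Submodule.sum_mem _ fun i _ => Submodule.smul_mem _ _ (Submodule.subset_span ⟨i, rfl⟩)⟩
  have hφ : Function.Injective φ := by
    intro ξ η h
    have h1 := congrArg (fun z : L => (z : EuclideanSpace ℝ (Fin d))) h
    funext i
    have h2 := congrArg (fun z : EuclideanSpace ℝ (Fin d) => z i) h1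
    simpa [φ] using h2
  refine (hs.comp_injective hφ).congr fun ξ => ?_
  have : ‖φ ξ‖ ^ 2 = ∑ i, ((ξ i : ℝ)) ^ 2 := by
    change ‖(WithLp.toLp 2 (fun i => (ξ i : ℝ)) : EuclideanSpace ℝ (Fin d))‖ ^ 2 = _
    rw [EuclideanSpace.norm_sq_eq]
    simp
  simp only [Function.comp]
  rw [← this, ← inv_pow, ← pow_mul]

theorem tsec_integral {d : ℕ} {r' : ℝ} (hr' : 0 < r') {g : EuclideanSpace ℝ (Fin d) → ℂ}
    (hg : AEStronglyMeasurable g (volume.restrict (fund d r' (fun _ => 1)))) :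
    ∫ t, g (tsec d r' t) = ((r' : ℂ) ^ d)⁻¹ * ∫ x in fund d r' (fun _ => 1), g x := by
  have h := tsec_mp d r' hr'
  rw [← integral_map h.measurable.aemeasurable (by
    rw [h.map_eq]; exact hg.smul_measure _), h.map_eq, integral_smul_measure,
    ENNReal.toReal_ofReal (by positivity), Complex.real_smul]
  push_cast
  rfl

theorem sum_sq_pos {d : ℕ} {ξ : Fin d → ℤ} (h : ξ ≠ 0) : 0 < ∑ i, ((ξ i : ℝ)) ^ 2 := by
  obtain ⟨i, hi⟩ := Function.ne_iff.mp h
  refine Finset.sum_pos' (fun _ _ => sq_nonneg _) ⟨i, Finset.mem_univ i, ?_⟩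
  have : (ξ i : ℝ) ≠ 0 := by exact_mod_cast hi
  positivity

/-- `-Δb = δ_{x₁} - δ_{x₂}` distributionally on the torus `ℝ^d/r'ℤ^d`: if `b ∈ L²` has the
Fourier coefficients of
`(1/4π²) ∑_{ξ≠0} (e(-ξ·x₁/r') - e(-ξ·x₂/r'))/(r'^d |ξ/r'|²) · e(ξ·x/r')`,
then for every `C²` `r'ℤ^d`-periodic `f : ℝ^d → ℂ`,
`f(x₁) - f(x₂) = ∫_{[0,r')^d} b · (-Δf) dμ`. -/
theorem green_difference_identity (d : ℕ) (hd : 0 < d) (hd3 : d ≤ 3)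
    (r' : ℝ) (hr' : 0 < r') (x₁ x₂ : EuclideanSpace ℝ (Fin d))
    (b : Lp ℂ 2 (volume.restrict (fund d r' (fun _ => 1))))
    (hb : ∀ ξ : Fin d → ℤ,
      (∫ x in fund d r' (fun _ => 1), (b : EuclideanSpace ℝ (Fin d) → ℂ) x *
          (starRingEnd ℂ) (ec d r' ξ x)) =
        if ξ = 0 then 0 else
          (1 / (4 * (Real.pi : ℂ) ^ 2)) * (ec d r' (-ξ) x₁ - ec d r' (-ξ) x₂) /
            ((((∑ i, ((ξ i : ℝ)) ^ 2) / r' ^ 2 : ℝ) : ℂ)))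
    (f : EuclideanSpace ℝ (Fin d) → ℂ) (hf : ContDiff ℝ 2 f)
    (hfper : LatPeriodic d r' (fun _ => 1) f) :
    f x₁ - f x₂ = ∫ x in fund d r' (fun _ => 1),
      (b : EuclideanSpace ℝ (Fin d) → ℂ) x * (-lap d f x) := by
  classical
  have hrc : (r' : ℂ) ≠ 0 := by exact_mod_cast hr'.ne'
  have hpi : (Real.pi : ℂ) ≠ 0 := by exact_mod_cast Real.pi_ne_zero
  have hLper : LatPeriodic d r' (fun _ => 1) (fun x => -lap d f x) := fun x i => by
    simp only [lap_per hfper x i]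
  let F : C(UnitAddTorus (Fin d), ℂ) := ⟨fun t => f (tsec d r' t), cont_sec hfper hf.continuous⟩
  let G : C(UnitAddTorus (Fin d), ℂ) :=
    ⟨fun t => -lap d f (tsec d r' t), cont_sec hLper (lap_cont hf).neg⟩
  set lam : (Fin d → ℤ) → ℂ := fun ξ =>
    4 * (Real.pi : ℂ) ^ 2 * (((∑ i, ((ξ i : ℝ)) ^ 2) / r' ^ 2 : ℝ) : ℂ) with hlam
  have hlam_neg : ∀ ξ, lam (-ξ) = lam ξ := by
    intro ξ; simp [hlam]
  have hlam0 : ∀ ξ, ξ ≠ 0 → lam ξ ≠ 0 := by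
    intro ξ hξ
    have := sum_sq_pos hξ
    have h2 : ((((∑ i, ((ξ i : ℝ)) ^ 2) / r' ^ 2 : ℝ) : ℂ)) ≠ 0 := by
      exact_mod_cast (by positivity : (∑ i, ((ξ i : ℝ)) ^ 2) / r' ^ 2 ≠ 0)
    simp only [hlam]
    exact mul_ne_zero (mul_ne_zero (by norm_num) (pow_ne_zero _ hpi)) h2
  -- coefficients of the Laplacian
  have hG : ∀ ξ, UnitAddTorus.mFourierCoeff G ξ = lam ξ * UnitAddTorus.mFourierCoeff F ξ := by
    intro ξ
    have hcf : ∀ g : EuclideanSpace ℝ (Fin d) → ℂ, Continuous g →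
        UnitAddTorus.mFourierCoeff (fun t => g (tsec d r' t)) ξ = ((r' : ℂ) ^ d)⁻¹ *
          ∫ x in fund d r' (fun _ => 1), g x * ec d r' (-ξ) x := by
      intro g hg
      rw [← tsec_integral hr' (g := fun x => g x * ec d r' (-ξ) x)
        (hg.mul (ec_contDiff (-ξ)).continuous).aestronglyMeasurable]
      unfold UnitAddTorus.mFourierCoeff
      refine integral_congr_ae (Eventually.of_forall fun t => ?_)
      simp only [smul_eq_mul, ec_sec hr']
      ring
    have h1 := hcf f hf.continuous
    have h2 := hcf (fun x => -lap d f x) (lap_cont hf).neg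
    change UnitAddTorus.mFourierCoeff (fun t => -lap d f (tsec d r' t)) ξ =
      lam ξ * UnitAddTorus.mFourierCoeff (fun t => f (tsec d r' t)) ξ
    rw [h1, h2, green_coeff hd hr' hf hfper (-ξ), ← hlam_neg ξ]
    ring
  -- absolute summability
  have hsum : Summable (UnitAddTorus.mFourierCoeff F) := by
    have s1 : Summable (fun ξ => ‖UnitAddTorus.mFourierCoeff G ξ‖ ^ 2) := by
      have := (UnitAddTorus.hasSum_sq_mFourierCoeff (G.toLp 2 volume ℂ)).summable
      simpa only [UnitAddTorus.mFourierCoeff_toLp] using this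
    have s2 := (summable_lat hd3).mul_left ((r' ^ 2 / (4 * Real.pi ^ 2)) ^ 2)
    refine Summable.of_norm_bounded_eventually (s1.add s2) ?_
    refine (Set.finite_singleton (0 : Fin d → ℤ)).subset ?_
    intro ξ hξ
    by_contra hne
    refine hξ ?_
    have hne : ξ ≠ 0 := hne
    have hp := sum_sq_pos hne
    have e1 : ‖UnitAddTorus.mFourierCoeff F ξ‖ = ‖UnitAddTorus.mFourierCoeff G ξ‖ *
        ((r' ^ 2 / (4 * Real.pi ^ 2)) * (∑ i, ((ξ i : ℝ)) ^ 2)⁻¹) := by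
      rw [hG, norm_mul]
      have : ‖lam ξ‖ = 4 * Real.pi ^ 2 * ((∑ i, ((ξ i : ℝ)) ^ 2) / r' ^ 2) := by
        simp only [hlam]
        rw [norm_mul, norm_mul, norm_pow, Complex.norm_real, Complex.norm_real,
          Real.norm_of_nonneg Real.pi_pos.le, Real.norm_of_nonneg (by positivity)]
        norm_num
      rw [this]
      have := Real.pi_pos
      field_simp
    change ‖UnitAddTorus.mFourierCoeff F ξ‖ ≤ ‖UnitAddTorus.mFourierCoeff G ξ‖ ^ 2 +
      (r' ^ 2 / (4 * Real.pi ^ 2)) ^ 2 * ((∑ i, ((ξ i : ℝ)) ^ 2)⁻¹) ^ 2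
    rw [e1, ← mul_pow]
    set u := ‖UnitAddTorus.mFourierCoeff G ξ‖
    set v := ((r' ^ 2 / (4 * Real.pi ^ 2)) * (∑ i, ((ξ i : ℝ)) ^ 2)⁻¹)
    nlinarith [sq_nonneg (u - v), sq_nonneg u, sq_nonneg v]
  have hinv : ∀ x : EuclideanSpace ℝ (Fin d),
      HasSum (fun ξ => UnitAddTorus.mFourierCoeff F ξ * ec d r' ξ x) (f x) := by
    intro x
    have hx : r' • (WithLp.toLp 2 (fun i => r'⁻¹ * x i) : EuclideanSpace ℝ (Fin d)) = x := by
      ext i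
      simp [hr'.ne']
    have := UnitAddTorus.hasSum_mFourier_series_apply_of_summable hsum
      (fun i => ((r'⁻¹ * x i : ℝ) : UnitAddCircle))
    simp only [ec_sec hr', smul_eq_mul] at this
    have e1 : ∀ ξ, ec d r' ξ (tsec d r' (fun i => ((r'⁻¹ * x i : ℝ) : UnitAddCircle))) =
        ec d r' ξ x := fun ξ => by
      rw [per_sec (ec_periodic hr' ξ) (fun i => r'⁻¹ * x i), hx]
    have e2 : F (fun i => ((r'⁻¹ * x i : ℝ) : UnitAddCircle)) = f x := by
      change f (tsec d r' _) = _
      rw [per_sec hfper (fun i => r'⁻¹ * x i), hx]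
    simpa only [e1, e2] using this
  -- the function `b` on the torus
  have hbm : MemLp (fun t => b (tsec d r' t)) 2 (volume : Measure (UnitAddTorus (Fin d))) := by
    have h1 : MemLp b 2 (ENNReal.ofReal ((r' ^ d)⁻¹) • volume.restrict (fund d r' (fun _ => 1))) :=
      (Lp.memLp b).smul_measure ENNReal.ofReal_ne_top
    exact h1.comp_measurePreserving (tsec_mp d r' hr')
  have hbs : AEStronglyMeasurable b (volume.restrict (fund d r' (fun _ => 1))) :=
    (Lp.memLp b).1
  have hB : ∀ ξ, UnitAddTorus.mFourierCoeff (hbm.toLp _) ξ = ((r' : ℂ) ^ d)⁻¹ *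
      ∫ x in fund d r' (fun _ => 1), b x * (starRingEnd ℂ) (ec d r' ξ x) := by
    intro ξ
    rw [← tsec_integral hr' (g := fun x => b x * (starRingEnd ℂ) (ec d r' ξ x))
        (hbs.mul (Complex.continuous_conj.comp (ec_contDiff ξ).continuous).aestronglyMeasurable)]
    unfold UnitAddTorus.mFourierCoeff
    refine integral_congr_ae ?_
    filter_upwards [hbm.coeFn_toLp] with t ht
    rw [ht, ec_sec hr', ec_neg, smul_eq_mul, mul_comm]
  have hGs : ∀ ξ, UnitAddTorus.mFourierCoeff (⇑(star G)) ξ =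
      (starRingEnd ℂ) (UnitAddTorus.mFourierCoeff G (-ξ)) := by
    intro ξ
    unfold UnitAddTorus.mFourierCoeff
    rw [← integral_conj]
    refine integral_congr_ae (Eventually.of_forall fun t => ?_)
    simp [UnitAddTorus.mFourier_neg]
  have hpars := UnitAddTorus.hasSum_prod_mFourierCoeff ((star G).toLp 2 volume ℂ) (hbm.toLp _)
  have hint : (∫ t, (starRingEnd ℂ) (((star G).toLp 2 volume ℂ : _) t) * (hbm.toLp _) t) =
      ((r' : ℂ) ^ d)⁻¹ * ∫ x in fund d r' (fun _ => 1), b x * (-lap d f x) := by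
    rw [← tsec_integral hr' (g := fun x => b x * (-lap d f x))
        (hbs.mul (lap_cont hf).neg.aestronglyMeasurable)]
    refine integral_congr_ae ?_
    filter_upwards [hbm.coeFn_toLp, (star G).coeFn_toLp (p := 2) (𝕜 := ℂ) volume] with t h1 h2
    rw [h1, h2]
    simp [G]
    ring
  rw [hint] at hpars
  have hterm : ∀ ξ, (starRingEnd ℂ) (UnitAddTorus.mFourierCoeff ((star G).toLp 2 volume ℂ) ξ) *
      UnitAddTorus.mFourierCoeff (hbm.toLp _) ξ = ((r' : ℂ) ^ d)⁻¹ *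
      (UnitAddTorus.mFourierCoeff F (-ξ) * ec d r' (-ξ) x₁ -
        UnitAddTorus.mFourierCoeff F (-ξ) * ec d r' (-ξ) x₂) := by
    intro ξ
    rw [UnitAddTorus.mFourierCoeff_toLp, hGs, Complex.conj_conj, hB, hb, hG, hlam_neg]
    split_ifs with h
    · subst h
      simp [ec]
    · have h0 := hlam0 ξ h
      have e : (1 / (4 * (Real.pi : ℂ) ^ 2)) * (ec d r' (-ξ) x₁ - ec d r' (-ξ) x₂) /
            ((((∑ i, ((ξ i : ℝ)) ^ 2) / r' ^ 2 : ℝ) : ℂ)) =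
            (ec d r' (-ξ) x₁ - ec d r' (-ξ) x₂) / lam ξ := by
        simp only [hlam]
        rw [mul_comm (1 / _), mul_one_div, div_div]
      rw [e]
      field_simp
  simp only [hterm] at hpars
  have hd1 := (((hinv x₁).sub (hinv x₂)).mul_left (((r' : ℂ) ^ d)⁻¹))
  have hd2 := (Equiv.neg (Fin d → ℤ)).hasSum_iff.2 hd1
  have := hd2.unique hpars
  exact mul_left_cancel₀ (inv_ne_zero (pow_ne_zero _ hrc)) this
end
end
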